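/- Let n ≥ 1 and let F be a real-valued elliptic functional on symmetric n×n matrices, i.e. F(A) ≤ F(B) whenever A ≤ B in the positive semidefinite order. Let u : ℝⁿ → ℝ be a smooth semiconvex function (there exists M with D²u(x) ≥ M·Iₙ for all x), let g(x) = Iₙ + (D²u(x))² be the induced metric on the gradient graph in x-coordinates, and suppose the function x ↦ F(D²u(x)) is smooth and satisfies Δ_g F(D²u) = 0, i.e. ∑_{i,j} ∂_j( √(det g(x)) (g(x)⁻¹)_{ij} ∂_i (F(D²u))(x) ) = 0 for all x. Then F(D²u(x)) is constant on ℝⁿ. -/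

import Mathlib

open Matrix Real

noncomputable section

/-- `ℝⁿ` with the Euclidean structure. -/
abbrev En (n : ℕ) := EuclideanSpace ℝ (Fin n)

/-- The partial derivative `∂ᵢ f (x)`. -/
def pdrv (n : ℕ) (i : Fin n) (f : En n → ℝ) (x : En n) : ℝ :=
  fderiv ℝ f x (EuclideanSpace.single i 1)

/-- The Hessian matrix `D²u(x)`. -/
def hess (n : ℕ) (u : En n → ℝ) (x : En n) : Matrix (Fin n) (Fin n) ℝ :=
  Matrix.of fun i j => pdrv n j (fun y => pdrv n i u y) x

/-- The divergence-form expression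
`∑_{i,j} ∂_j( √(det g(x)) (g(x)⁻¹)_{ij} ∂_i f(x) )` for the Laplace–Beltrami
operator of the metric `g` in coordinates. -/
def lapBel (n : ℕ) (g : En n → Matrix (Fin n) (Fin n) ℝ) (f : En n → ℝ) (x : En n) : ℝ :=
  ∑ i, ∑ j, pdrv n j (fun y => Real.sqrt (g y).det * (g y)⁻¹ i j * pdrv n i f y) x

section Helpers

open MeasureTheory Set Filter Topology Metric
open scoped ENNReal NNReal


/-- A Faber Krahn type inequality, from Gagliardo, Nirenberg, Sobolev and Hölder. -/
lemma faber_krahn (n : ℕ) (hn : 2 ≤ n) : ∃ C : ℝ, 0 < C ∧ ∀ (f : En n → ℝ) (S : Set (En n)),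
    ContDiff ℝ 1 f → HasCompactSupport f → (∀ x, 0 ≤ f x) → MeasurableSet S → volume S ≠ ∞ →
    (∀ x, x ∉ S → f x = 0) →
    (∫ x, f x) ^ n ≤ C * volume.real S * (∫ x, ‖fderiv ℝ f x‖) ^ n := by
  have hn1 : (1 : ℝ≥0) < (n : ℝ≥0) := by exact_mod_cast hn
  set p : ℝ≥0 := NNReal.conjExponent (n : ℝ≥0) with hp
  have hpc : NNReal.HolderConjugate (n : ℝ≥0) p := NNReal.HolderConjugate.conjExponent hn1
  have hpc' : NNReal.HolderConjugate (Module.finrank ℝ (En n)) p := by simpa using hpc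
  set K : ℝ≥0 := eLpNormLESNormFDerivOneConst (volume : Measure (En n)) p with hK
  refine ⟨(K : ℝ) ^ n + 1, by positivity, ?_⟩
  intro f S hf hfc hf0 hS hSf hfS
  have h1 := eLpNorm_le_eLpNorm_fderiv_one (volume : Measure (En n)) hf hfc hpc'
  have hfi : Integrable f := hf.continuous.integrable_of_hasCompactSupport hfc
  have hdi : Integrable (fderiv ℝ f) :=
    (hf.continuous_fderiv one_ne_zero).integrable_of_hasCompactSupport (hfc.fderiv ℝ)
  have hp1 : (1 : ℝ≥0∞) ≤ p := by
    have := hpc.symm.lt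
    exact_mod_cast this.le
  have h2 := eLpNorm_le_eLpNorm_mul_rpow_measure_univ (μ := volume.restrict S) hp1
    hf.continuous.aestronglyMeasurable
  have h3 : eLpNorm f 1 (volume.restrict S) = ENNReal.ofReal (∫ x, f x) := by
    rw [eLpNorm_one_eq_lintegral_enorm, ofReal_integral_eq_lintegral_ofReal hfi
      (Eventually.of_forall hf0), ← lintegral_indicator hS]
    congr 1
    ext x
    by_cases hx : x ∈ S
    · simp [hx, Real.enorm_of_nonneg (hf0 x)]
    · simp [hx, hfS x hx]
  have h4 : eLpNorm (fderiv ℝ f) 1 volume = ENNReal.ofReal (∫ x, ‖fderiv ℝ f x‖) := by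
    rw [eLpNorm_one_eq_lintegral_enorm, ofReal_integral_eq_lintegral_ofReal hdi.norm
      (Eventually.of_forall fun x => norm_nonneg _)]
    congr 1
    ext x
    simp
  have h5 : eLpNorm f p (volume.restrict S) ≤ eLpNorm f p volume :=
    eLpNorm_mono_measure _ Measure.restrict_le_self
  have hexp : (1 / (1 : ℝ≥0∞).toReal - 1 / ((p : ℝ≥0∞)).toReal) = (n : ℝ)⁻¹ := by
    have := hpc.coe.inv_add_inv_eq_inv
    simp at this ⊢
    linarith
  rw [h3, hexp, Measure.restrict_apply MeasurableSet.univ, univ_inter] at h2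
  rw [h4] at h1
  have h6 : ENNReal.ofReal (∫ x, f x) ≤
      (K * ENNReal.ofReal (∫ x, ‖fderiv ℝ f x‖)) * volume S ^ (n : ℝ)⁻¹ :=
    h2.trans (mul_le_mul_left (h5.trans h1) _)
  have h7 := pow_le_pow_left' h6 n
  rw [mul_pow, mul_pow, ← ENNReal.rpow_natCast (volume S ^ (n : ℝ)⁻¹), ← ENNReal.rpow_mul,
    inv_mul_cancel₀ (by positivity), ENNReal.rpow_one] at h7
  have I1 : 0 ≤ ∫ x, f x := integral_nonneg hf0
  have I2 : 0 ≤ ∫ x, ‖fderiv ℝ f x‖ := integral_nonneg fun x => norm_nonneg _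
  have h8 := ENNReal.toReal_mono (by finiteness) h7
  simp only [ENNReal.toReal_mul, ENNReal.toReal_pow, ENNReal.toReal_ofReal I1,
    ENNReal.toReal_ofReal I2, ENNReal.coe_toReal] at h8
  change _ ≤ _ * volume.real S at h8
  have : 0 ≤ volume.real S * (∫ x, ‖fderiv ℝ f x‖) ^ n := by positivity
  nlinarith

/-- Cutoff functions. -/
lemma exists_cutoff (n : ℕ) : ∃ C : ℝ, 0 < C ∧ ∀ (y : En n) (r R : ℝ), 0 < r → r < R →
    ∃ η : En n → ℝ, ContDiff ℝ 1 η ∧ HasCompactSupport η ∧ (∀ x, 0 ≤ η x) ∧ (∀ x, η x ≤ 1) ∧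
      (∀ x ∈ ball y r, η x = 1) ∧ (∀ x, x ∉ ball y R → η x = 0) ∧
      (∀ x, x ∉ ball y R → fderiv ℝ η x = 0) ∧
      (∀ x, ‖fderiv ℝ η x‖ ≤ C / (R - r)) := by
  have hst : ContDiff ℝ 1 Real.smoothTransition := Real.smoothTransition.contDiff
  obtain ⟨K, hK⟩ : ∃ K : ℝ, ∀ t, |deriv Real.smoothTransition t| ≤ K := by
    have hc : Continuous (deriv Real.smoothTransition) := hst.continuous_deriv le_rfl
    obtain ⟨K, hK⟩ := (isCompact_Icc (a := (0 : ℝ)) (b := 1)).exists_bound_of_continuousOn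
      hc.continuousOn
    refine ⟨max K 0, fun t => ?_⟩
    by_cases ht : t ∈ Icc (0 : ℝ) 1
    · exact (hK t ht).trans (le_max_left _ _)
    · have : deriv Real.smoothTransition t = 0 := by
        rcases lt_or_ge t 0 with h | h
        · have : Real.smoothTransition =ᶠ[𝓝 t] fun _ => 0 := by
            filter_upwards [gt_mem_nhds h] with s hs
            exact Real.smoothTransition.zero_of_nonpos hs.le
          rw [this.deriv_eq]; simp
        · have h1 : 1 < t := by
            by_contra h'; exact ht ⟨h, not_lt.1 h'⟩
          have : Real.smoothTransition =ᶠ[𝓝 t] fun _ => 1 := by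
            filter_upwards [lt_mem_nhds h1] with s hs
            exact Real.smoothTransition.one_of_one_le hs.le
          rw [this.deriv_eq]; simp
      rw [this]; simp
  have hK0 : 0 ≤ K := (abs_nonneg _).trans (hK 0)
  refine ⟨2 * K + 1, by positivity, fun y r R hr hrR => ?_⟩
  have hRr : 0 < R ^ 2 - r ^ 2 := by nlinarith
  set q : En n → ℝ := fun x => (R ^ 2 - ‖x - y‖ ^ 2) / (R ^ 2 - r ^ 2) with hq
  have hqd : ∀ x, HasFDerivAt q ((R ^ 2 - r ^ 2)⁻¹ • (-((2 : ℝ) • innerSL ℝ (x - y)))) x := by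
    intro x
    have h1 : HasFDerivAt (fun x : En n => ‖x - y‖ ^ 2) ((2 : ℝ) • innerSL ℝ (x - y)) x := by
      have := ((hasFDerivAt_id x).sub_const y).norm_sq
      convert! this using 1
      ext z
      simp [two_mul]
    have h2 := (h1.const_sub (R ^ 2)).const_mul (R ^ 2 - r ^ 2)⁻¹
    refine h2.congr_of_eventuallyEq (Eventually.of_forall fun x => ?_)
    simp [hq, div_eq_inv_mul]
  have hηd : ∀ x, HasFDerivAt (fun x => Real.smoothTransition (q x))
      (deriv Real.smoothTransition (q x) •
        ((R ^ 2 - r ^ 2)⁻¹ • (-((2 : ℝ) • innerSL ℝ (x - y))))) x := fun x =>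
    ((hst.differentiable one_ne_zero) (q x)).hasDerivAt.comp_hasFDerivAt x (hqd x)
  have hz : ∀ x, x ∉ ball y R → Real.smoothTransition (q x) = 0 := by
    intro x hx
    apply Real.smoothTransition.zero_of_nonpos
    rw [mem_ball, dist_eq_norm, not_lt] at hx
    apply div_nonpos_of_nonpos_of_nonneg _ hRr.le
    nlinarith
  have hcs : HasCompactSupport (fun x => Real.smoothTransition (q x)) := by
    apply HasCompactSupport.intro (isCompact_closedBall y R)
    intro x hx
    exact hz x fun h => hx (ball_subset_closedBall h)
  have hdz : ∀ x, x ∉ ball y R → deriv Real.smoothTransition (q x) = 0 := by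
    intro x hx
    have h0 := hz x hx
    apply IsLocalMin.deriv_eq_zero
    apply Eventually.of_forall
    intro t
    rw [h0]; exact Real.smoothTransition.nonneg _
  refine ⟨fun x => Real.smoothTransition (q x), ?_, hcs, fun x => Real.smoothTransition.nonneg _,
    fun x => Real.smoothTransition.le_one _, ?_, hz, ?_, ?_⟩
  · apply hst.comp
    have : ContDiff ℝ 1 (fun x : En n => ‖x - y‖ ^ 2) := (contDiff_id.sub contDiff_const).norm_sq ℝ
    exact (contDiff_const.sub this).div_const _
  · intro x hx
    apply Real.smoothTransition.one_of_one_le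
    rw [mem_ball, dist_eq_norm] at hx
    rw [hq, le_div_iff₀ hRr]
    have := norm_nonneg (x - y)
    nlinarith
  · intro x hx
    rw [(hηd x).fderiv, hdz x hx, zero_smul]
  · intro x
    rw [(hηd x).fderiv]
    by_cases hx : x ∈ ball y R
    · rw [mem_ball, dist_eq_norm] at hx
      rw [norm_smul, norm_smul, norm_neg, norm_smul, innerSL_apply_norm, norm_inv, Real.norm_eq_abs,
        Real.norm_eq_abs, abs_of_pos hRr, Real.norm_eq_abs, abs_two, le_div_iff₀ (by linarith)]
      have e : R ^ 2 - r ^ 2 = (R - r) * (R + r) := by ring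
      have h1 : (R ^ 2 - r ^ 2)⁻¹ * (2 * ‖x - y‖) * (R - r) ≤ 2 := by
        rw [e, mul_inv]
        have : R - r ≠ 0 := by linarith
        field_simp
        rw [div_le_iff₀ (by linarith)]
        linarith
      have h2 := hK (q x)
      have h3 : 0 ≤ (R ^ 2 - r ^ 2)⁻¹ * (2 * ‖x - y‖) * (R - r) := by
        have : 0 ≤ R - r := by linarith
        positivity
      calc |deriv Real.smoothTransition (q x)| * ((R ^ 2 - r ^ 2)⁻¹ * (2 * ‖x - y‖)) * (R - r)
          = |deriv Real.smoothTransition (q x)| *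
            ((R ^ 2 - r ^ 2)⁻¹ * (2 * ‖x - y‖) * (R - r)) := by ring
        _ ≤ K * 2 := by gcongr
        _ ≤ 2 * K + 1 := by linarith
    · rw [hdz x hx, zero_smul, norm_zero]
      have : 0 < R - r := by linarith
      positivity



/-- Continuous, uniformly elliptic, bounded coefficients (acting on covectors). -/
structure UEll (n : ℕ) (a : En n → (En n →L[ℝ] ℝ) →ₗ[ℝ] (En n →L[ℝ] ℝ) →ₗ[ℝ] ℝ)
    (l L : ℝ) : Prop where
  cont : ∀ p q : En n → (En n →L[ℝ] ℝ), Continuous p → Continuous q →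
    Continuous fun x => a x (p x) (q x)
  lpos : 0 < l
  Lpos : 0 < L
  bdd : ∀ x p q, |a x p q| ≤ L * ‖p‖ * ‖q‖
  coer : ∀ x p, l * ‖p‖ ^ 2 ≤ a x p p

/-- Weak subsolutions. -/
def WSub (n : ℕ) (a : En n → (En n →L[ℝ] ℝ) →ₗ[ℝ] (En n →L[ℝ] ℝ) →ₗ[ℝ] ℝ)
    (v : En n → ℝ) : Prop :=
  ∀ φ : En n → ℝ, ContDiff ℝ 1 φ → HasCompactSupport φ → (∀ x, 0 ≤ φ x) →
    ∫ x, a x (fderiv ℝ v x) (fderiv ℝ φ x) ≤ 0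

/-- Weak solutions. -/
def WSol (n : ℕ) (a : En n → (En n →L[ℝ] ℝ) →ₗ[ℝ] (En n →L[ℝ] ℝ) →ₗ[ℝ] ℝ)
    (v : En n → ℝ) : Prop :=
  ∀ φ : En n → ℝ, ContDiff ℝ 1 φ → HasCompactSupport φ →
    ∫ x, a x (fderiv ℝ v x) (fderiv ℝ φ x) = 0

lemma hasDerivAt_sq_pp (t : ℝ) : HasDerivAt (fun t : ℝ => max t 0 ^ 2) (2 * max t 0) t := by
  rcases lt_trichotomy t 0 with h | h | h
  · rw [max_eq_right h.le, mul_zero]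
    refine (hasDerivAt_const t (0 : ℝ)).congr_of_eventuallyEq ?_
    filter_upwards [gt_mem_nhds h] with s hs
    simp [max_eq_right hs.le]
  · subst h
    simp only [max_self, mul_zero]
    rw [hasDerivAt_iff_isLittleO]
    simp only [max_self, sub_zero, smul_zero]
    have : (fun x : ℝ => max x 0 ^ 2 - 0 ^ 2) =O[𝓝 0] fun x => x ^ 2 := by
      apply Asymptotics.IsBigO.of_bound 1
      apply Eventually.of_forall
      intro x
      rcases le_total x 0 with h | h <;> simp [h, sq_nonneg]
    exact this.trans_isLittleO (by simpa using Asymptotics.isLittleO_pow_id (𝕜 := ℝ) one_lt_two)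
  · rw [max_eq_left h.le]
    have := hasDerivAt_pow 2 t
    simp at this
    refine this.congr_of_eventuallyEq ?_
    filter_upwards [lt_mem_nhds h] with s hs
    simp [max_eq_left hs.le]

lemma contDiff_sq_pp : ContDiff ℝ 1 (fun t : ℝ => max t 0 ^ 2) := by
  rw [contDiff_one_iff_deriv]
  refine ⟨fun t => (hasDerivAt_sq_pp t).differentiableAt, ?_⟩
  have : deriv (fun t : ℝ => max t 0 ^ 2) = fun t => 2 * max t 0 :=
    funext fun t => (hasDerivAt_sq_pp t).deriv
  rw [this]
  fun_prop

lemma energy_pointwise {l L η s ε X Y A B : ℝ} (hl : 0 < l) (hL : 0 < L) (hη : 0 ≤ η)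
    (hs : 0 ≤ s) (hε : 0 < ε) (hX : 0 ≤ X) (hY : 0 ≤ Y) (hA : l * X ^ 2 ≤ A)
    (hB : |B| ≤ L * X * Y) :
    l ^ 2 / 2 * (η ^ 2 * (s / √(s ^ 2 + ε ^ 2)) * X ^ 2) - 2 * L ^ 2 * (Y ^ 2 * s ^ 2) ≤
      l * (η ^ 2 * (s / √(s ^ 2 + ε ^ 2)) * A + 2 * η * (√(s ^ 2 + ε ^ 2) - ε) * B) := by
  set ρ := √(s ^ 2 + ε ^ 2) with hρ
  have hρ2 : ρ ^ 2 = s ^ 2 + ε ^ 2 := Real.sq_sqrt (by positivity)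
  have hρ0 : 0 < ρ := Real.sqrt_pos.2 (by positivity)
  have hερ : ε ≤ ρ := Real.le_sqrt_of_sq_le (by nlinarith)
  have hρs : ρ ≤ s + ε := by
    rw [hρ]; apply Real.sqrt_le_iff.2; constructor <;> nlinarith
  set G := ρ - ε with hG
  have hG0 : 0 ≤ G := by linarith
  have hGs : G ≤ s := by linarith
  set m := s / ρ with hm
  have hm0 : 0 ≤ m := by positivity
  have hmρ : m * ρ = s := by rw [hm]; field_simp
  have hGG : G ^ 2 ≤ m * s ^ 2 := by
    have h1 : G * ρ ≤ s ^ 2 := by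
      have : G * (ρ + ε) = s ^ 2 := by rw [hG]; nlinarith
      nlinarith
    have h2 : G ^ 2 * ρ ≤ m * s ^ 2 * ρ := by
      have : m * s ^ 2 * ρ = s * s ^ 2 := by rw [← hmρ]; ring
      rw [this]
      nlinarith [mul_le_mul hGs h1 (by positivity) hs]
    exact le_of_mul_le_mul_right h2 hρ0
  have hGm : G ≤ √m * s := by
    refine (sq_le_sq₀ hG0 (by positivity)).1 ?_
    rw [mul_pow, Real.sq_sqrt hm0]
    exact hGG
  have hmm : √m ^ 2 = m := Real.sq_sqrt hm0
  have hB' : -(L * X * Y) ≤ B := (abs_le.1 hB).1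
  have h1 : η ^ 2 * m * (l * X ^ 2) ≤ η ^ 2 * m * A := by gcongr
  have h2 : 2 * η * G * (-(L * X * Y)) ≤ 2 * η * G * B := by gcongr
  have h3 : 2 * η * L * X * Y * G ≤ 2 * η * L * X * Y * (√m * s) := by gcongr
  have h4 := sq_nonneg (l * (η * X * √m) - 2 * L * (Y * s))
  have h5 : (η * X * √m) ^ 2 = η ^ 2 * m * X ^ 2 := by rw [mul_pow, hmm]; ring
  nlinarith [mul_le_mul_of_nonneg_left h1 hl.le, mul_le_mul_of_nonneg_left h2 hl.le,
    mul_le_mul_of_nonneg_left h3 hl.le]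

/-- Caccioppoli inequality. -/
lemma energy {n : ℕ} {a : En n → (En n →L[ℝ] ℝ) →ₗ[ℝ] (En n →L[ℝ] ℝ) →ₗ[ℝ] ℝ} {l L : ℝ}
    (ha : UEll n a l L) {v : En n → ℝ} (hv : ContDiff ℝ 1 v) (hsub : WSub n a v)
    {η : En n → ℝ} (hη : ContDiff ℝ 1 η) (hηc : HasCompactSupport η) (hη0 : ∀ x, 0 ≤ η x)
    (k : ℝ) {ε : ℝ} (hε : 0 < ε) :
    l ^ 2 * ∫ x, η x ^ 2 * (max (v x - k) 0 / √(max (v x - k) 0 ^ 2 + ε ^ 2)) *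
        ‖fderiv ℝ v x‖ ^ 2 ≤
      4 * L ^ 2 * ∫ x, ‖fderiv ℝ η x‖ ^ 2 * max (v x - k) 0 ^ 2 := by
  set s : En n → ℝ := fun x => max (v x - k) 0 with hs
  have hs0 : ∀ x, 0 ≤ s x := fun x => le_max_right _ _
  have hsc : Continuous s := by have := hv.continuous; fun_prop
  set ρ : En n → ℝ := fun x => √(s x ^ 2 + ε ^ 2) with hρ
  have hρc : Continuous ρ := by fun_prop
  have hρ0 : ∀ x, 0 < ρ x := fun x => Real.sqrt_pos.2 (by positivity)
  have hs2 : ContDiff ℝ 1 (fun x => s x ^ 2) := contDiff_sq_pp.comp (hv.sub contDiff_const)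
  have hvd : ∀ x, HasFDerivAt v (fderiv ℝ v x) x := fun x =>
    ((hv.differentiable one_ne_zero) x).hasFDerivAt
  have hηd : ∀ x, HasFDerivAt η (fderiv ℝ η x) x := fun x =>
    ((hη.differentiable one_ne_zero) x).hasFDerivAt
  have hs2d : ∀ x, HasFDerivAt (fun x => s x ^ 2) ((2 * s x) • fderiv ℝ v x) x := fun x => by
    have h := (hasDerivAt_sq_pp (v x - k)).comp_hasFDerivAt x ((hvd x).sub_const k)
    exact h
  have hρC : ContDiff ℝ 1 ρ := (hs2.add contDiff_const).sqrt fun x => by positivity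
  have hρd : ∀ x, HasFDerivAt ρ ((s x / ρ x) • fderiv ℝ v x) x := by
    intro x
    have := ((hs2d x).add_const (ε ^ 2)).sqrt (by positivity)
    convert! this using 1
    rw [smul_smul]
    congr 1
    have := (hρ0 x).ne'
    simp only [hρ] at this ⊢
    field_simp
  set φ : En n → ℝ := fun x => η x ^ 2 * (ρ x - ε) with hφ
  have hφC : ContDiff ℝ 1 φ := (hη.pow 2).mul (hρC.sub contDiff_const)
  have hφc : HasCompactSupport φ := by
    apply HasCompactSupport.mul_right
    exact hηc.comp_left (g := fun t : ℝ => t ^ 2) (by simp)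
  have hφ0 : ∀ x, 0 ≤ φ x := fun x => by
    have : ε ≤ ρ x := Real.le_sqrt_of_sq_le (by nlinarith [sq_nonneg (s x)])
    exact mul_nonneg (sq_nonneg _) (by linarith)
  have hφd : ∀ x, fderiv ℝ φ x = (η x ^ 2 * (s x / ρ x)) • fderiv ℝ v x +
      (2 * η x * (ρ x - ε)) • fderiv ℝ η x := by
    intro x
    have := ((hηd x).pow 2).mul ((hρd x).sub_const ε)
    rw [HasFDerivAt.fderiv (f := φ) this]
    ext z
    simp
    ring
  have key := hsub φ hφC hφc hφ0
  have hvc := hv.continuous_fderiv one_ne_zero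
  have hηc' := hη.continuous_fderiv one_ne_zero
  have hφc' := hφC.continuous_fderiv one_ne_zero
  have hpt : ∀ x, l ^ 2 / 2 * (η x ^ 2 * (s x / ρ x) * ‖fderiv ℝ v x‖ ^ 2) -
      2 * L ^ 2 * (‖fderiv ℝ η x‖ ^ 2 * s x ^ 2) ≤
      l * a x (fderiv ℝ v x) (fderiv ℝ φ x) := by
    intro x
    rw [hφd x, map_add, map_smul, map_smul, smul_eq_mul, smul_eq_mul]
    exact energy_pointwise ha.lpos ha.Lpos (hη0 x) (hs0 x) hε (norm_nonneg _) (norm_nonneg _)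
      (ha.coer x _) (ha.bdd x _ _)
  have i1 : Integrable (fun x => η x ^ 2 * (s x / ρ x) * ‖fderiv ℝ v x‖ ^ 2) := by
    apply Continuous.integrable_of_hasCompactSupport
    · have h := hη.continuous
      have : Continuous fun x => s x / ρ x := hsc.div hρc fun x => (hρ0 x).ne'
      fun_prop
    · apply HasCompactSupport.mul_right
      apply HasCompactSupport.mul_right
      exact hηc.comp_left (g := fun t : ℝ => t ^ 2) (by simp)
  have i2 : Integrable (fun x => ‖fderiv ℝ η x‖ ^ 2 * s x ^ 2) := by
    apply Continuous.integrable_of_hasCompactSupport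
    · fun_prop
    · apply HasCompactSupport.mul_right
      exact (hηc.fderiv ℝ).comp_left (g := fun t => ‖t‖ ^ 2) (by simp)
  have i3 : Integrable (fun x => a x (fderiv ℝ v x) (fderiv ℝ φ x)) := by
    apply Continuous.integrable_of_hasCompactSupport
    · exact ha.cont _ _ hvc hφc'
    · refine (hφc.fderiv ℝ).mono ?_
      intro x hx hx'
      apply hx
      simp [hx']
  have := integral_mono ((i1.const_mul _).sub (i2.const_mul _)) (i3.const_mul l) hpt
  simp only [Pi.sub_apply] at this
  rw [integral_sub (i1.const_mul _) (i2.const_mul _), integral_const_mul, integral_const_mul,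
    integral_const_mul] at this
  have h2 := mul_nonpos_of_nonneg_of_nonpos ha.lpos.le key
  linarith

lemma integrableOn_ball {n : ℕ} {f : En n → ℝ} (hf : Continuous f) (y : En n) (R : ℝ) :
    IntegrableOn f (ball y R) :=
  (hf.continuousOn.integrableOn_compact (isCompact_closedBall y R)).mono_set ball_subset_closedBall

lemma grad_bound {n : ℕ} {a : En n → (En n →L[ℝ] ℝ) →ₗ[ℝ] (En n →L[ℝ] ℝ) →ₗ[ℝ] ℝ} {l L : ℝ}
    (ha : UEll n a l L) {v : En n → ℝ} (hv : ContDiff ℝ 1 v) (hsub : WSub n a v)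
    {η : En n → ℝ} (hη : ContDiff ℝ 1 η) (hηc : HasCompactSupport η) (hη0 : ∀ x, 0 ≤ η x)
    (hη1 : ∀ x, η x ≤ 1) {y : En n} {R D : ℝ} (hD : 0 < D)
    (hz : ∀ x, x ∉ ball y R → η x = 0) (hdz : ∀ x, x ∉ ball y R → fderiv ℝ η x = 0)
    (hd : ∀ x, ‖fderiv ℝ η x‖ ≤ D) (k : ℝ) :
    ∫ x, ‖fderiv ℝ (fun x => η x ^ 2 * max (v x - k) 0 ^ 2) x‖ ≤
      (3 + 4 * L ^ 2 / l ^ 2) * D * ∫ x in ball y R, max (v x - k) 0 ^ 2 := by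
  set s : En n → ℝ := fun x => max (v x - k) 0 with hs
  have hs0 : ∀ x, 0 ≤ s x := fun x => le_max_right _ _
  have hsc : Continuous s := by have := hv.continuous; fun_prop
  have hs2 : ContDiff ℝ 1 (fun x => s x ^ 2) := contDiff_sq_pp.comp (hv.sub contDiff_const)
  have hvd : ∀ x, HasFDerivAt v (fderiv ℝ v x) x := fun x =>
    ((hv.differentiable one_ne_zero) x).hasFDerivAt
  have hηd : ∀ x, HasFDerivAt η (fderiv ℝ η x) x := fun x =>
    ((hη.differentiable one_ne_zero) x).hasFDerivAt
  have hs2d : ∀ x, HasFDerivAt (fun x => s x ^ 2) ((2 * s x) • fderiv ℝ v x) x := fun x => by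
    have h := (hasDerivAt_sq_pp (v x - k)).comp_hasFDerivAt x ((hvd x).sub_const k)
    exact h
  have hfd : ∀ x, fderiv ℝ (fun x => η x ^ 2 * s x ^ 2) x =
      (η x ^ 2 * (2 * s x)) • fderiv ℝ v x + (s x ^ 2 * (2 * η x)) • fderiv ℝ η x := by
    intro x
    have := ((hηd x).pow 2).mul (hs2d x)
    rw [HasFDerivAt.fderiv (f := fun x => η x ^ 2 * s x ^ 2) this]
    ext z
    simp
    ring
  have hvc := hv.continuous_fderiv one_ne_zero
  have hηc' := hη.continuous_fderiv one_ne_zero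
  have hηcc := hη.continuous
  have hfc := ((hη.pow 2).mul hs2).continuous_fderiv one_ne_zero
  change ∫ x, ‖fderiv ℝ (fun x => η x ^ 2 * s x ^ 2) x‖ ≤
      (3 + 4 * L ^ 2 / l ^ 2) * D * ∫ x in ball y R, s x ^ 2
  have hl := ha.lpos
  -- main estimate for each ε
  have main : ∀ ε : ℝ, 0 < ε → ∫ x, ‖fderiv ℝ (fun x => η x ^ 2 * s x ^ 2) x‖ ≤
      (3 + 4 * L ^ 2 / l ^ 2) * D * (∫ x in ball y R, s x ^ 2) +
        ε * (D * ∫ x in ball y R, s x) := by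
    intro ε hε
    have he := energy ha hv hsub hη hηc hη0 k hε
    change l ^ 2 * ∫ x, η x ^ 2 * (s x / √(s x ^ 2 + ε ^ 2)) * ‖fderiv ℝ v x‖ ^ 2 ≤
      4 * L ^ 2 * ∫ x, ‖fderiv ℝ η x‖ ^ 2 * s x ^ 2 at he
    set ρ : En n → ℝ := fun x => √(s x ^ 2 + ε ^ 2) with hρ
    have hρc : Continuous ρ := by fun_prop
    have hρ0 : ∀ x, 0 < ρ x := fun x => Real.sqrt_pos.2 (by positivity)
    have hρs : ∀ x, ρ x ≤ s x + ε := fun x => by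
      apply Real.sqrt_le_iff.2
      have := hs0 x
      constructor <;> nlinarith
    have hmc : Continuous fun x => s x / ρ x := hsc.div hρc fun x => (hρ0 x).ne'
    have e1 : ∫ x, ‖fderiv ℝ (fun x => η x ^ 2 * s x ^ 2) x‖ =
        ∫ x in ball y R, ‖fderiv ℝ (fun x => η x ^ 2 * s x ^ 2) x‖ := by
      symm
      apply setIntegral_eq_integral_of_forall_compl_eq_zero
      intro x hx
      rw [hfd x, hz x hx]
      simp
    have e2 : ∫ x, η x ^ 2 * (s x / ρ x) * ‖fderiv ℝ v x‖ ^ 2 =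
        ∫ x in ball y R, η x ^ 2 * (s x / ρ x) * ‖fderiv ℝ v x‖ ^ 2 := by
      symm
      apply setIntegral_eq_integral_of_forall_compl_eq_zero
      intro x hx
      rw [hz x hx]
      simp
    have e3 : ∫ x, ‖fderiv ℝ η x‖ ^ 2 * s x ^ 2 =
        ∫ x in ball y R, ‖fderiv ℝ η x‖ ^ 2 * s x ^ 2 := by
      symm
      apply setIntegral_eq_integral_of_forall_compl_eq_zero
      intro x hx
      rw [hdz x hx]
      simp
    have hpt : ∀ x, ‖fderiv ℝ (fun x => η x ^ 2 * s x ^ 2) x‖ ≤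
        (3 * D) * s x ^ 2 + (ε * D) * s x +
          D⁻¹ * (η x ^ 2 * (s x / ρ x) * ‖fderiv ℝ v x‖ ^ 2) := by
      intro x
      have h0 := hs0 x
      have h1 := hη0 x
      have h2 := hη1 x
      have h3 := hd x
      have h4 := hρ0 x
      have h5 := hρs x
      rw [hfd x]
      refine (norm_add_le _ _).trans ?_
      rw [norm_smul, norm_smul, Real.norm_of_nonneg (by positivity),
        Real.norm_of_nonneg (by positivity)]
      set X := ‖fderiv ℝ v x‖
      have t1 : s x ^ 2 * (2 * η x) * ‖fderiv ℝ η x‖ ≤ s x ^ 2 * (2 * 1) * D := by gcongr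
      have t2 : 2 * s x * X ≤ D * (s x * ρ x) + D⁻¹ * ((s x / ρ x) * X ^ 2) := by
        have h6 : D * (s x * ρ x) + D⁻¹ * ((s x / ρ x) * X ^ 2) - 2 * s x * X =
            s x * (D * ρ x - X) ^ 2 / (D * ρ x) := by
          field_simp
          ring
        have : 0 ≤ s x * (D * ρ x - X) ^ 2 / (D * ρ x) := by positivity
        linarith
      have t3 : η x ^ 2 * (2 * s x * X) ≤
          η x ^ 2 * (D * (s x * ρ x) + D⁻¹ * ((s x / ρ x) * X ^ 2)) := by gcongr
      have t4 : η x ^ 2 * (D * (s x * ρ x)) ≤ 1 * (D * (s x * (s x + ε))) := by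
        gcongr
        nlinarith
      nlinarith
    have j1 : IntegrableOn (fun x => ‖fderiv ℝ (fun x => η x ^ 2 * s x ^ 2) x‖) (ball y R) :=
      integrableOn_ball hfc.norm y R
    have j2 : IntegrableOn (fun x => (3 * D) * s x ^ 2) (ball y R) :=
      integrableOn_ball (by fun_prop) y R
    have j3 : IntegrableOn (fun x => (ε * D) * s x) (ball y R) :=
      integrableOn_ball (by fun_prop) y R
    have j4 : IntegrableOn (fun x => D⁻¹ * (η x ^ 2 * (s x / ρ x) * ‖fderiv ℝ v x‖ ^ 2))
        (ball y R) := integrableOn_ball (by fun_prop) y R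
    have h1 := integral_mono (μ := volume.restrict (ball y R)) j1 ((j2.add j3).add j4) hpt
    rw [integral_add' (j2.add j3) j4, integral_add' j2 j3, integral_const_mul, integral_const_mul,
      integral_const_mul] at h1
    have h2 : ∫ x in ball y R, ‖fderiv ℝ η x‖ ^ 2 * s x ^ 2 ≤
        D ^ 2 * ∫ x in ball y R, s x ^ 2 := by
      rw [← integral_const_mul]
      apply integral_mono (μ := volume.restrict (ball y R))
        (integrableOn_ball (by fun_prop) y R) (integrableOn_ball (by fun_prop) y R)
      intro x
      have := hd x
      dsimp only
      gcongr
    rw [e2, e3] at he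
    rw [e1]
    set I1 := ∫ x in ball y R, η x ^ 2 * (s x / ρ x) * ‖fderiv ℝ v x‖ ^ 2
    set I2 := ∫ x in ball y R, s x ^ 2
    have h3 : I1 ≤ 4 * L ^ 2 / l ^ 2 * D ^ 2 * I2 := by
      have : l ^ 2 * I1 ≤ l ^ 2 * (4 * L ^ 2 / l ^ 2 * D ^ 2 * I2) := by
        calc l ^ 2 * I1 ≤ 4 * L ^ 2 * (D ^ 2 * I2) := he.trans (by gcongr)
          _ = _ := by field_simp
      exact le_of_mul_le_mul_left this (by positivity)
    have h4 : D⁻¹ * I1 ≤ 4 * L ^ 2 / l ^ 2 * D * I2 := by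
      calc D⁻¹ * I1 ≤ D⁻¹ * (4 * L ^ 2 / l ^ 2 * D ^ 2 * I2) := by gcongr
        _ = _ := by field_simp
    nlinarith
  set J := D * ∫ x in ball y R, s x
  have hJ : 0 ≤ J := mul_nonneg hD.le (setIntegral_nonneg measurableSet_ball fun x _ => hs0 x)
  apply le_of_forall_pos_le_add
  intro δ hδ
  refine (main (δ / (J + 1)) (by positivity)).trans ?_
  gcongr
  rw [div_mul_eq_mul_div, div_le_iff₀ (by positivity)]
  nlinarith



/-- One step of the De Giorgi iteration. -/
lemma degiorgi_step {n : ℕ} (hn : 2 ≤ n)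
    {a : En n → (En n →L[ℝ] ℝ) →ₗ[ℝ] (En n →L[ℝ] ℝ) →ₗ[ℝ] ℝ} {l L : ℝ}
    (ha : UEll n a l L) : ∃ C : ℝ, 0 < C ∧ ∀ (v : En n → ℝ), ContDiff ℝ 1 v → WSub n a v →
    ∀ (y : En n) (r R k k' : ℝ), 0 < r → r < R → k < k' →
    (∫ x in ball y r, max (v x - k') 0 ^ 2) ^ n * ((R - r) ^ n * (k' - k) ^ 2) ≤
      C * (∫ x in ball y R, max (v x - k) 0 ^ 2) ^ (n + 1) := by
  obtain ⟨C1, hC1, FK⟩ := faber_krahn n hn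
  obtain ⟨C2, hC2, CO⟩ := exists_cutoff n
  have hl := ha.lpos
  have hL := ha.Lpos
  refine ⟨C1 * ((3 + 4 * L ^ 2 / l ^ 2) * C2) ^ n, by positivity, ?_⟩
  intro v hv hsub y r R k k' hr hrR hkk
  obtain ⟨η, hη, hηc, hη0, hη1, hone, hz, hdz, hd⟩ := CO y r R hr hrR
  have hRr : 0 < R - r := by linarith
  have hvc := hv.continuous
  have hηcc := hη.continuous
  have gb := grad_bound ha hv hsub hη hηc hη0 hη1 (D := C2 / (R - r)) (by positivity) hz hdz hd k'
  set s' : En n → ℝ := fun x => max (v x - k') 0 with hs'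
  set s : En n → ℝ := fun x => max (v x - k) 0 with hs
  have hs'0 : ∀ x, 0 ≤ s' x := fun x => le_max_right _ _
  have hs0 : ∀ x, 0 ≤ s x := fun x => le_max_right _ _
  have hsc : Continuous s := by fun_prop
  have hs'c : Continuous s' := by fun_prop
  have hss : ∀ x, s' x ≤ s x := fun x => max_le_max (by linarith) le_rfl
  set f : En n → ℝ := fun x => η x ^ 2 * s' x ^ 2 with hf
  change ∫ x, ‖fderiv ℝ f x‖ ≤ (3 + 4 * L ^ 2 / l ^ 2) * (C2 / (R - r)) *
    ∫ x in ball y R, s' x ^ 2 at gb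
  have hfC : ContDiff ℝ 1 f := (hη.pow 2).mul (contDiff_sq_pp.comp (hv.sub contDiff_const))
  have hfc : HasCompactSupport f := by
    apply HasCompactSupport.mul_right
    exact hηc.comp_left (g := fun t : ℝ => t ^ 2) (by simp)
  set S : Set (En n) := ball y R ∩ {x | k' < v x} with hS
  have hSm : MeasurableSet S :=
    measurableSet_ball.inter (isOpen_lt continuous_const hvc).measurableSet
  have hSf : volume S ≠ ∞ :=
    ((measure_mono inter_subset_left).trans_lt measure_ball_lt_top).ne
  have hfS : ∀ x, x ∉ S → f x = 0 := by
    intro x hx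
    by_cases h : x ∈ ball y R
    · have : v x ≤ k' := by
        by_contra h'
        exact hx ⟨h, not_le.1 h'⟩
      have : s' x = 0 := max_eq_right (by linarith)
      simp [hf, this]
    · simp [hf, hz x h]
  have key := FK f S hfC hfc (fun x => by positivity) hSm hSf hfS
  set Y := ∫ x in ball y R, s x ^ 2 with hY
  have hY0 : 0 ≤ Y := setIntegral_nonneg measurableSet_ball fun x _ => sq_nonneg _
  have g1 : ∫ x in ball y R, s' x ^ 2 ≤ Y := by
    apply integral_mono (μ := volume.restrict (ball y R))
      (integrableOn_ball (by fun_prop) y R) (integrableOn_ball (by fun_prop) y R)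
    intro x
    have := hss x
    have := hs'0 x
    dsimp only
    gcongr
  have g2 : ∫ x in ball y r, s' x ^ 2 ≤ ∫ x, f x := by
    have e : ∫ x in ball y r, s' x ^ 2 = ∫ x in ball y r, f x := by
      apply setIntegral_congr_fun measurableSet_ball
      intro x hx
      simp [hf, hone x hx]
    rw [e]
    apply setIntegral_le_integral (hfC.continuous.integrable_of_hasCompactSupport hfc)
    exact Eventually.of_forall fun x => by positivity
  have g3 : volume.real S * (k' - k) ^ 2 ≤ Y := by
    have : ∫ x in S, (k' - k) ^ 2 ≤ ∫ x in S, s x ^ 2 := by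
      apply setIntegral_mono_on (integrableOn_const hSf)
        ((integrableOn_ball (by fun_prop) y R).mono_set inter_subset_left) hSm
      intro x hx
      have h1 : k' < v x := hx.2
      have h2 : k' - k ≤ s x := le_max_of_le_left (by linarith)
      have h3 : 0 ≤ k' - k := by linarith
      gcongr
    rw [setIntegral_const, smul_eq_mul] at this
    refine this.trans ?_
    apply setIntegral_mono_set (integrableOn_ball (by fun_prop) y R)
    · exact Eventually.of_forall fun x => sq_nonneg _
    · exact Eventually.of_forall fun x hx => hx.1
  have g0 : 0 ≤ ∫ x in ball y r, s' x ^ 2 :=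
    setIntegral_nonneg measurableSet_ball fun x _ => sq_nonneg _
  have g4 : ∫ x, ‖fderiv ℝ f x‖ ≤ (3 + 4 * L ^ 2 / l ^ 2) * (C2 / (R - r)) * Y :=
    gb.trans (by gcongr)
  have g5 : 0 ≤ ∫ x, ‖fderiv ℝ f x‖ := integral_nonneg fun x => norm_nonneg _
  calc (∫ x in ball y r, s' x ^ 2) ^ n * ((R - r) ^ n * (k' - k) ^ 2)
      ≤ (∫ x, f x) ^ n * ((R - r) ^ n * (k' - k) ^ 2) := by gcongr
    _ ≤ (C1 * volume.real S * (∫ x, ‖fderiv ℝ f x‖) ^ n) * ((R - r) ^ n * (k' - k) ^ 2) := by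
        gcongr
    _ = C1 * (volume.real S * (k' - k) ^ 2) * ((∫ x, ‖fderiv ℝ f x‖) * (R - r)) ^ n := by
        rw [mul_pow]; ring
    _ ≤ C1 * Y * (((3 + 4 * L ^ 2 / l ^ 2) * (C2 / (R - r)) * Y) * (R - r)) ^ n := by
        gcongr
    _ = C1 * Y * (((3 + 4 * L ^ 2 / l ^ 2) * C2) * Y) ^ n := by
        congr 2
        field_simp
    _ = C1 * ((3 + 4 * L ^ 2 / l ^ 2) * C2) ^ n * Y ^ (n + 1) := by
        rw [mul_pow]; ring

/-- Local boundedness of subsolutions (De Giorgi). -/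
lemma local_max {n : ℕ} (hn : 2 ≤ n)
    {a : En n → (En n →L[ℝ] ℝ) →ₗ[ℝ] (En n →L[ℝ] ℝ) →ₗ[ℝ] ℝ} {l L : ℝ}
    (ha : UEll n a l L) : ∃ ε₀ : ℝ, 0 < ε₀ ∧ ∀ (v : En n → ℝ), ContDiff ℝ 1 v → WSub n a v →
    ∀ (y : En n) (R k : ℝ), 0 < R → 0 < k →
    (∫ x in ball y R, max (v x) 0 ^ 2) ≤ ε₀ * R ^ n * k ^ 2 →
    ∀ x ∈ ball y (R / 2), v x ≤ k := by
  obtain ⟨C, hC, ST⟩ := degiorgi_step hn ha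
  set θ : ℝ := (2 ^ n * 4)⁻¹ with hθ
  have hθ0 : 0 < θ := by positivity
  have hθ1 : θ < 1 := by
    rw [hθ]; apply inv_lt_one_of_one_lt₀
    have : (1 : ℝ) ≤ 2 ^ n := one_le_pow₀ (by norm_num)
    linarith
  refine ⟨θ ^ n / (C * 4 ^ (n + 1)), by positivity, ?_⟩
  intro v hv hsub y R k hR hk h0
  set ε₀ := θ ^ n / (C * 4 ^ (n + 1)) with hε
  have hε0 : 0 < ε₀ := by positivity
  set T := ε₀ * R ^ n * k ^ 2 with hT
  have hT0 : 0 < T := by positivity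
  have hvc := hv.continuous
  set r : ℕ → ℝ := fun j => R / 2 + R / 2 * (2⁻¹) ^ j with hr
  set κ : ℕ → ℝ := fun j => k - k * (2⁻¹) ^ j with hκ
  have hr0 : ∀ j, R / 2 < r j := fun j => by
    have : 0 < R / 2 * (2⁻¹) ^ j := by positivity
    simp only [hr]; linarith
  set Y : ℕ → ℝ := fun j => ∫ x in ball y (r j), max (v x - κ j) 0 ^ 2 with hY
  have hY0 : ∀ j, 0 ≤ Y j := fun j => setIntegral_nonneg measurableSet_ball fun x _ => sq_nonneg _
  have claim : ∀ j, Y j ≤ T * θ ^ j := by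
    intro j
    induction j with
    | zero => simpa [hY, hr, hκ] using h0
    | succ j ih =>
      have hd1 : r j - r (j + 1) = R * ((2⁻¹) ^ j * 4⁻¹) := by
        simp only [hr, pow_succ]; ring
      have hd2 : κ (j + 1) - κ j = k * ((2⁻¹) ^ j * 2⁻¹) := by
        simp only [hκ, pow_succ]; ring
      have st := ST v hv hsub y (r (j + 1)) (r j) (κ j) (κ (j + 1))
        ((by positivity : (0 : ℝ) < R / 2).trans (hr0 _))
        (by have : 0 < R * ((2⁻¹ : ℝ) ^ j * 4⁻¹) := by positivity
            linarith)
        (by have : 0 < k * ((2⁻¹ : ℝ) ^ j * 2⁻¹) := by positivity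
            linarith)
      rw [hd1, hd2] at st
      change Y (j + 1) ^ n * _ ≤ C * Y j ^ (n + 1) at st
      set b : ℝ := 2⁻¹ ^ j with hb
      have hb0 : 0 < b := by positivity
      have h1 : Y j ^ (n + 1) ≤ (T * θ ^ j) ^ (n + 1) := by gcongr
      have hθb : θ ^ j = b ^ n * b ^ 2 := by
        rw [hθ, hb, inv_pow, mul_pow, mul_inv, ← pow_mul, ← pow_mul, ← pow_mul, inv_pow, inv_pow,
          mul_comm n j, pow_mul _ j 2, ← pow_mul, mul_comm j 2, pow_mul _ 2 j]
        norm_num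
      have hfac : (0 : ℝ) < (R * (b * 4⁻¹)) ^ n * (k * (b * 2⁻¹)) ^ 2 := by positivity
      have h2 : C * (T * θ ^ j) ^ (n + 1) =
          (T * θ ^ (j + 1)) ^ n * ((R * (b * 4⁻¹)) ^ n * (k * (b * 2⁻¹)) ^ 2) := by
        have e1 : (T * θ ^ j) ^ (n + 1) = (T * θ ^ j) ^ n * (T * θ ^ j) := pow_succ _ _
        have e2 : (T * θ ^ (j + 1)) ^ n = (T * θ ^ j) ^ n * θ ^ n := by
          rw [← mul_pow]; congr 1; ring
        rw [e1, e2, mul_left_comm, mul_assoc ((T * θ ^ j) ^ n)]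
        congr 1
        rw [hθb, hT, hε]
        simp only [mul_pow, inv_pow, pow_succ]
        field_simp
        norm_num
      have h3 : Y (j + 1) ^ n ≤ (T * θ ^ (j + 1)) ^ n := by
        refine le_of_mul_le_mul_right ?_ hfac
        rw [← h2]
        exact st.trans (by gcongr)
      exact le_of_pow_le_pow_left₀ (by omega) (by positivity) h3
  set I := ∫ x in ball y (R / 2), max (v x - k) 0 ^ 2 with hI
  have hIY : ∀ j, I ≤ T * θ ^ j := by
    intro j
    refine le_trans ?_ (claim j)
    calc I ≤ ∫ x in ball y (r j), max (v x - k) 0 ^ 2 := by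
          apply setIntegral_mono_set (integrableOn_ball (by fun_prop) y _)
          · exact Eventually.of_forall fun x => sq_nonneg _
          · exact (ball_subset_ball (hr0 j).le).eventuallyLE
      _ ≤ Y j := by
          apply integral_mono (μ := volume.restrict (ball y (r j)))
            (integrableOn_ball (by fun_prop) y _) (integrableOn_ball (by fun_prop) y _)
          intro x
          have : κ j ≤ k := by
            have : 0 < k * (2⁻¹ : ℝ) ^ j := by positivity
            simp only [hκ]; linarith
          dsimp only
          gcongr
  have hI0 : I ≤ 0 := by
    have ht : Tendsto (fun j : ℕ => T * θ ^ j) atTop (𝓝 (T * 0)) :=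
      (tendsto_pow_atTop_nhds_zero_of_lt_one hθ0.le hθ1).const_mul T
    rw [mul_zero] at ht
    exact ge_of_tendsto' ht hIY
  intro x hx
  by_contra hlt
  rw [not_le] at hlt
  have hpos : 0 < I := by
    rw [hI, setIntegral_pos_iff_support_of_nonneg_ae
      (Eventually.of_forall fun x => sq_nonneg _) (integrableOn_ball (by fun_prop) y _)]
    have ho : IsOpen ({x | k < v x} ∩ ball y (R / 2)) :=
      (isOpen_lt continuous_const hvc).inter isOpen_ball
    refine (ho.measure_pos volume ⟨x, hlt, hx⟩).trans_le (measure_mono ?_)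
    rintro z ⟨hz1, hz2⟩
    refine ⟨?_, hz2⟩
    have : 0 < max (v z - k) 0 := lt_max_of_lt_left (by simpa using hz1)
    simp only [Function.mem_support]
    positivity
  linarith



lemma lintegral_scale {n : ℕ} {g : En n → ℝ≥0∞} (hg : Measurable g) (c : En n) {t : ℝ}
    (ht : t ≠ 0) : ∫⁻ x, g (c + t • x) = ENNReal.ofReal |(t ^ n)⁻¹| * ∫⁻ x, g x := by
  have h1 := Measure.map_addHaar_smul (volume : Measure (En n)) ht
  have h2 : ∫⁻ x, g (c + x) = ∫⁻ x, g x := lintegral_add_left_eq_self g c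
  have h3 : ∫⁻ x, g (c + t • x) = ∫⁻ x, g (c + x) ∂(Measure.map (t • ·) volume) := by
    rw [lintegral_map (by fun_prop) (by fun_prop)]
  rw [h3, h1, lintegral_smul_measure, h2]
  simp

lemma lintegral_contract {n : ℕ} {g : En n → ℝ≥0∞} (hg : Measurable g) (y : En n) (R : ℝ)
    {t : ℝ} (ht : 1 / 2 ≤ t) (ht1 : t ≤ 1) {z : En n} (hz : z ∈ ball y R) :
    ∫⁻ x in ball y R, g (z + t • (x - z)) ≤ 2 ^ n * ∫⁻ x in ball y R, g x := by
  have e : ∀ x, z + t • (x - z) = ((1 - t) • z) + t • x := by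
    intro x; module
  have hm : Measurable ((ball y R).indicator g) := hg.indicator measurableSet_ball
  calc ∫⁻ x in ball y R, g (z + t • (x - z))
      ≤ ∫⁻ x, (ball y R).indicator g (((1 - t) • z) + t • x) := by
        rw [← lintegral_indicator measurableSet_ball]
        apply lintegral_mono
        intro x
        by_cases hx : x ∈ ball y R
        · have : ((1 - t) • z) + t • x ∈ ball y R :=
            (convex_ball y R) hz hx (by linarith) (by linarith) (by ring)
          simp only [hx, indicator_of_mem, this]
          rw [e]
        · simp [hx]
    _ = ENNReal.ofReal |(t ^ n)⁻¹| * ∫⁻ x, (ball y R).indicator g x :=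
        lintegral_scale hm _ (by linarith)
    _ ≤ 2 ^ n * ∫⁻ x in ball y R, g x := by
        rw [lintegral_indicator measurableSet_ball]
        gcongr
        have h2 : (2 : ℝ≥0∞) ^ n = ENNReal.ofReal (2 ^ n) := by
          rw [ENNReal.ofReal_pow (by norm_num)]; simp
        rw [h2]
        apply ENNReal.ofReal_le_ofReal
        rw [abs_of_pos (by positivity), ← inv_pow]
        gcongr
        rw [inv_le_comm₀ (by linarith) (by norm_num)]
        linarith

lemma segment_sq {n : ℕ} {v : En n → ℝ} (hv : ContDiff ℝ 1 v) (x z : En n) :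
    ENNReal.ofReal ((v x - v z) ^ 2) ≤ ENNReal.ofReal (‖x - z‖ ^ 2) *
      ∫⁻ t in Icc (0 : ℝ) 1, ENNReal.ofReal (‖fderiv ℝ v (z + t • (x - z))‖ ^ 2) := by
  have hvc := hv.continuous_fderiv one_ne_zero
  have hc : Continuous fun t : ℝ => fderiv ℝ v (z + t • (x - z)) := by fun_prop
  set f : ℝ → ℝ := fun t => fderiv ℝ v (z + t • (x - z)) (x - z) with hf
  have hfc : Continuous f := by fun_prop
  have hd : ∀ t : ℝ, HasDerivAt (fun t : ℝ => v (z + t • (x - z))) (f t) t := by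
    intro t
    have h1 : HasDerivAt (fun t : ℝ => z + t • (x - z)) (x - z) t := by
      simpa using ((hasDerivAt_id t).smul_const (x - z)).const_add z
    exact ((hv.differentiable one_ne_zero) _).hasFDerivAt.comp_hasDerivAt t h1
  have hI : ∫ t in (0 : ℝ)..1, f t = v x - v z := by
    rw [intervalIntegral.integral_eq_sub_of_hasDerivAt (fun t _ => hd t)
      (hfc.intervalIntegrable 0 1)]
    simp
  set m := v x - v z with hm
  have hJ : m ^ 2 ≤ ∫ t in (0 : ℝ)..1, ‖x - z‖ ^ 2 * ‖fderiv ℝ v (z + t • (x - z))‖ ^ 2 := by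
    have h1 : ∫ t in (0 : ℝ)..1, (2 * m * f t - m ^ 2) = m ^ 2 := by
      rw [intervalIntegral.integral_sub ((hfc.intervalIntegrable 0 1).const_mul _) (by simp),
        intervalIntegral.integral_const_mul, hI]
      simp
      ring
    rw [← h1]
    apply intervalIntegral.integral_mono_on zero_le_one
    · exact Continuous.intervalIntegrable (by fun_prop) _ _
    · exact Continuous.intervalIntegrable (by fun_prop) _ _
    · intro t _
      have h2 : |f t| ≤ ‖fderiv ℝ v (z + t • (x - z))‖ * ‖x - z‖ :=
        (fderiv ℝ v (z + t • (x - z))).le_opNorm (x - z)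
      have h3 : f t ^ 2 ≤ (‖fderiv ℝ v (z + t • (x - z))‖ * ‖x - z‖) ^ 2 :=
        sq_le_sq' (abs_le.1 h2).1 (abs_le.1 h2).2
      nlinarith [sq_nonneg (f t - m)]
  rw [intervalIntegral.integral_const_mul, intervalIntegral.integral_of_le zero_le_one,
    ← integral_Icc_eq_integral_Ioc] at hJ
  have h4 := ENNReal.ofReal_le_ofReal hJ
  rw [ENNReal.ofReal_mul (by positivity), ofReal_integral_eq_lintegral_ofReal] at h4
  · exact h4
  · exact ContinuousOn.integrableOn_compact isCompact_Icc (by fun_prop)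
  · exact Eventually.of_forall fun t => by positivity

/-- Poincaré inequality for functions which are nonpositive on a large set. -/
lemma poincare {n : ℕ} {v : En n → ℝ} (hv : ContDiff ℝ 1 v) (y : En n) {R : ℝ} (hR : 0 < R)
    (Z : Set (En n)) (hZm : MeasurableSet Z) (hZ : Z ⊆ ball y R) (hvZ : ∀ z ∈ Z, v z ≤ 0) :
    volume.real Z * ∫ x in ball y R, max (v x) 0 ^ 2 ≤
      (2 * R) ^ 2 * (2 ^ n * volume.real (ball y R)) * ∫ x in ball y R, ‖fderiv ℝ v x‖ ^ 2 := by
  have hvc := hv.continuous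
  have hvc' := hv.continuous_fderiv one_ne_zero
  set G : En n → ℝ≥0∞ := fun x => ENNReal.ofReal (‖fderiv ℝ v x‖ ^ 2) with hG
  have hGc : Continuous G := ENNReal.continuous_ofReal.comp (by fun_prop)
  have hGm : Measurable G := hGc.measurable
  set B := ball y R with hB
  set w : En n → ℝ≥0∞ := fun x => ENNReal.ofReal (max (v x) 0 ^ 2) with hw
  have hwm : Measurable w := (ENNReal.continuous_ofReal.comp (by fun_prop)).measurable
  set K := ENNReal.ofReal ((2 * R) ^ 2) with hK
  have hpt : ∀ z ∈ Z, ∀ x ∈ B, w x ≤ K * ∫⁻ t in Icc (0 : ℝ) 1, G (z + t • (x - z)) := by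
    intro z hz x hx
    calc w x ≤ ENNReal.ofReal ((v x - v z) ^ 2) := by
          apply ENNReal.ofReal_le_ofReal
          rcases le_total (v x) 0 with h | h
          · rw [max_eq_right h, zero_pow two_ne_zero]; exact sq_nonneg _
          · rw [max_eq_left h]
            have := hvZ z hz
            gcongr
            linarith
      _ ≤ _ := segment_sq hv x z
      _ ≤ _ := by
          gcongr
          rw [hK]
          apply ENNReal.ofReal_le_ofReal
          have h1 : ‖x - z‖ ≤ 2 * R := by
            rw [← dist_eq_norm]
            have h2 : dist x y < R := hx
            have h3 : dist z y < R := hZ hz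
            linarith [dist_triangle_right x z y]
          gcongr
  have hTot : ∀ t ∈ Icc (0 : ℝ) 1, ∫⁻ z in B, ∫⁻ x in B, G (z + t • (x - z)) ≤
      volume B * (2 ^ n * ∫⁻ x in B, G x) := by
    intro t ht
    rcases le_total (1 / 2) t with h | h
    · calc ∫⁻ z in B, ∫⁻ x in B, G (z + t • (x - z)) ≤ ∫⁻ z in B, (2 ^ n * ∫⁻ x in B, G x) := by
            apply setLIntegral_mono measurable_const
            intro z hz
            exact lintegral_contract hGm y R h ht.2 hz
        _ = _ := by rw [setLIntegral_const, mul_comm]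
    · have hsw : ∫⁻ z in B, ∫⁻ x in B, G (z + t • (x - z)) =
          ∫⁻ x in B, ∫⁻ z in B, G (z + t • (x - z)) := by
        apply lintegral_lintegral_swap
        apply Measurable.aemeasurable
        apply Continuous.measurable
        exact hGc.comp (by fun_prop)
      rw [hsw]
      calc ∫⁻ x in B, ∫⁻ z in B, G (z + t • (x - z)) ≤ ∫⁻ x in B, (2 ^ n * ∫⁻ x in B, G x) := by
            apply setLIntegral_mono measurable_const
            intro x hx
            have e : ∀ z, z + t • (x - z) = x + (1 - t) • (z - x) := by intro z; module
            simp only [e]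
            exact lintegral_contract hGm y R (by linarith) (by linarith [ht.1]) hx
        _ = _ := by rw [setLIntegral_const, mul_comm]
  have main : volume Z * ∫⁻ x in B, w x ≤ K * (volume B * (2 ^ n * ∫⁻ x in B, G x)) := by
    calc volume Z * ∫⁻ x in B, w x = ∫⁻ z in Z, ∫⁻ x in B, w x := by
          rw [setLIntegral_const, mul_comm]
      _ ≤ ∫⁻ z in Z, ∫⁻ x in B, K * ∫⁻ t in Icc (0 : ℝ) 1, G (z + t • (x - z)) := by
          apply setLIntegral_mono' hZm
          intro z hz
          apply setLIntegral_mono' measurableSet_ball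
          intro x hx
          exact hpt z hz x hx
      _ ≤ ∫⁻ z in B, ∫⁻ x in B, K * ∫⁻ t in Icc (0 : ℝ) 1, G (z + t • (x - z)) :=
          lintegral_mono_set hZ
      _ = ∫⁻ z in B, K * ∫⁻ t in Icc (0 : ℝ) 1, ∫⁻ x in B, G (z + t • (x - z)) := by
          congr 1
          ext z
          rw [lintegral_const_mul' _ _ ENNReal.ofReal_ne_top]
          congr 1
          apply lintegral_lintegral_swap
          apply Measurable.aemeasurable
          apply Continuous.measurable
          exact hGc.comp (by fun_prop)
      _ = K * ∫⁻ t in Icc (0 : ℝ) 1, ∫⁻ z in B, ∫⁻ x in B, G (z + t • (x - z)) := by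
          rw [lintegral_const_mul' _ _ ENNReal.ofReal_ne_top]
          congr 1
          apply lintegral_lintegral_swap
          apply Measurable.aemeasurable
          have : Measurable fun p : (En n × ℝ) × En n => G (p.1.1 + p.1.2 • (p.2 - p.1.1)) :=
            (hGc.comp (by fun_prop)).measurable
          exact this.lintegral_prod_right'
      _ ≤ K * ∫⁻ t in Icc (0 : ℝ) 1, volume B * (2 ^ n * ∫⁻ x in B, G x) := by
          gcongr K * ?_
          exact setLIntegral_mono' measurableSet_Icc hTot
      _ = _ := by
          rw [setLIntegral_const]; simp
  have hGi : IntegrableOn (fun x => ‖fderiv ℝ v x‖ ^ 2) B := integrableOn_ball (by fun_prop) y R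
  have hwi : IntegrableOn (fun x => max (v x) 0 ^ 2) B := integrableOn_ball (by fun_prop) y R
  rw [← ofReal_integral_eq_lintegral_ofReal hGi (Eventually.of_forall fun t => by positivity),
    ← ofReal_integral_eq_lintegral_ofReal hwi (Eventually.of_forall fun t => by positivity)] at main
  have hBf : volume B ≠ ∞ := measure_ball_lt_top.ne
  have m2 := ENNReal.toReal_mono (by finiteness) main
  simp only [ENNReal.toReal_mul, ENNReal.toReal_pow, hK] at m2
  rw [ENNReal.toReal_ofReal (integral_nonneg fun x => by positivity),
    ENNReal.toReal_ofReal (integral_nonneg fun x => by positivity),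
    ENNReal.toReal_ofReal (by positivity)] at m2
  simp only [ENNReal.toReal_ofNat] at m2
  change volume.real Z * _ ≤ _ * (volume.real B * _) at m2
  linarith



lemma log_hasFDerivAt {n : ℕ} {H : En n → ℝ} (hH : ContDiff ℝ 1 H) (hpos : ∀ x, 0 < H x) (c : ℝ)
    (x : En n) : HasFDerivAt (fun x => c - Real.log (H x)) (-((H x)⁻¹ • fderiv ℝ H x)) x :=
  ((((hH.differentiable one_ne_zero) x).hasFDerivAt).log (hpos x).ne').const_sub c

lemma log_identity {n : ℕ} {a : En n → (En n →L[ℝ] ℝ) →ₗ[ℝ] (En n →L[ℝ] ℝ) →ₗ[ℝ] ℝ}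
    {H : En n → ℝ} (hH : ContDiff ℝ 1 H) (hpos : ∀ x, 0 < H x)
    (hsol : WSol n a H) (c : ℝ) {v : En n → ℝ} (hv : v = fun x => c - Real.log (H x))
    {φ : En n → ℝ} (hφ : ContDiff ℝ 1 φ) (hφc : HasCompactSupport φ) :
    ∫ x, (a x (fderiv ℝ v x) (fderiv ℝ φ x) +
      φ x * a x (fderiv ℝ v x) (fderiv ℝ v x)) = 0 := by
  have hd : ∀ x, fderiv ℝ v x = -((H x)⁻¹ • fderiv ℝ H x) := fun x => by
    rw [hv]; exact (log_hasFDerivAt hH hpos c x).fderiv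
  have hψC : ContDiff ℝ 1 (fun x => φ x * (H x)⁻¹) := hφ.mul (hH.inv fun x => (hpos x).ne')
  have hψc : HasCompactSupport (fun x => φ x * (H x)⁻¹) := hφc.mul_right
  have key := hsol _ hψC hψc
  rw [← neg_eq_zero, ← integral_neg, ← key]
  congr 1
  ext x
  have h1 : HasFDerivAt φ (fderiv ℝ φ x) x := ((hφ.differentiable one_ne_zero) x).hasFDerivAt
  have h2 : HasFDerivAt H (fderiv ℝ H x) x := ((hH.differentiable one_ne_zero) x).hasFDerivAt
  have h3 := h1.mul ((hasDerivAt_inv (hpos x).ne').comp_hasFDerivAt x h2)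
  have h4 : fderiv ℝ (fun x => φ x * (H x)⁻¹) x =
      (H x)⁻¹ • fderiv ℝ φ x - (φ x * ((H x) ^ 2)⁻¹) • fderiv ℝ H x := by
    have h5 : HasFDerivAt (fun x => φ x * (H x)⁻¹) _ x := h3
    rw [h5.fderiv]
    ext z
    simp
    ring
  rw [h4, hd x]
  simp only [map_neg, map_smul, map_sub, LinearMap.neg_apply, LinearMap.smul_apply, smul_eq_mul]
  have := (hpos x).ne'
  field_simp
  ring

lemma log_sub {n : ℕ} {a : En n → (En n →L[ℝ] ℝ) →ₗ[ℝ] (En n →L[ℝ] ℝ) →ₗ[ℝ] ℝ} {l L : ℝ}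
    (ha : UEll n a l L) {H : En n → ℝ} (hH : ContDiff ℝ 1 H) (hpos : ∀ x, 0 < H x)
    (hsol : WSol n a H) (c : ℝ) {v : En n → ℝ} (hv : v = fun x => c - Real.log (H x)) :
    WSub n a v := by
  intro φ hφ hφc hφ0
  have hvC : ContDiff ℝ 1 v := by
    rw [hv]; exact contDiff_const.sub (hH.log fun x => (hpos x).ne')
  have hvc' := hvC.continuous_fderiv one_ne_zero
  have hφc' := hφ.continuous_fderiv one_ne_zero
  have key := log_identity hH hpos hsol c hv hφ hφc
  have i1 : Integrable fun x => a x (fderiv ℝ v x) (fderiv ℝ φ x) := by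
    apply Continuous.integrable_of_hasCompactSupport
    · exact ha.cont _ _ hvc' hφc'
    · refine (hφc.fderiv ℝ).mono ?_
      intro x hx hx'
      apply hx
      simp [hx']
  have i2 : Integrable fun x => φ x * a x (fderiv ℝ v x) (fderiv ℝ v x) := by
    apply Continuous.integrable_of_hasCompactSupport
    · exact hφ.continuous.mul (ha.cont _ _ hvc' hvc')
    · exact hφc.mul_right
  rw [integral_add i1 i2] at key
  have : 0 ≤ ∫ x, φ x * a x (fderiv ℝ v x) (fderiv ℝ v x) := by
    apply integral_nonneg
    intro x
    have := ha.coer x (fderiv ℝ v x)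
    have hl := ha.lpos
    exact mul_nonneg (hφ0 x) (le_trans (by positivity) this)
  linarith

lemma volume_ball_En {n : ℕ} (y : En n) {R : ℝ} (hR : 0 < R) :
    volume.real (ball y R) = R ^ n * volume.real (ball (0 : En n) 1) := by
  have := Measure.addHaar_ball_of_pos (volume : Measure (En n)) y hR
  rw [Measure.real, this, ENNReal.toReal_mul, ENNReal.toReal_ofReal (by positivity)]
  simp [Measure.real]

lemma log_energy {n : ℕ} {a : En n → (En n →L[ℝ] ℝ) →ₗ[ℝ] (En n →L[ℝ] ℝ) →ₗ[ℝ] ℝ} {l L : ℝ}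
    (ha : UEll n a l L) : ∃ C : ℝ, 0 < C ∧ ∀ H : En n → ℝ, ContDiff ℝ 1 H → (∀ x, 0 < H x) →
    WSol n a H → ∀ (c : ℝ) (y : En n) (R : ℝ), 0 < R →
    R ^ 2 * ∫ x in ball y R, ‖fderiv ℝ (fun x => c - Real.log (H x)) x‖ ^ 2 ≤ C * R ^ n := by
  obtain ⟨C2, hC2, CO⟩ := exists_cutoff n
  have hl := ha.lpos
  have hL := ha.Lpos
  refine ⟨4 * L ^ 2 / l ^ 2 * (C2 ^ 2 * (2 ^ n * volume.real (ball (0 : En n) 1))) + 1,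
    by positivity, ?_⟩
  intro H hH hpos hsol c y R hR
  obtain ⟨η, hη, hηc, hη0, hη1, hone, hz, hdz, hd⟩ := CO y R (2 * R) hR (by linarith)
  have hRR : 2 * R - R = R := by ring
  rw [hRR] at hd
  set v : En n → ℝ := fun x => c - Real.log (H x) with hv
  have hvC : ContDiff ℝ 1 v := contDiff_const.sub (hH.log fun x => (hpos x).ne')
  have hvc' := hvC.continuous_fderiv one_ne_zero
  have hηc' := hη.continuous_fderiv one_ne_zero
  have hηcc := hη.continuous
  have hη2c : HasCompactSupport fun x => η x ^ 2 :=
    hηc.comp_left (g := fun t : ℝ => t ^ 2) (by simp)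
  have key := log_identity hH hpos hsol c hv (hη.pow 2) hη2c
  have hη2d : ∀ x, fderiv ℝ (fun x => η x ^ 2) x = (2 * η x) • fderiv ℝ η x := by
    intro x
    have h : HasFDerivAt (fun x => η x ^ 2) _ x :=
      (((hη.differentiable one_ne_zero) x).hasFDerivAt).pow 2
    rw [h.fderiv]
    ext z
    simp
  have i1 : Integrable (fun x => η x ^ 2 * ‖fderiv ℝ v x‖ ^ 2) := by
    apply Continuous.integrable_of_hasCompactSupport
    · fun_prop
    · exact hη2c.mul_right
  have i2 : Integrable (fun x => ‖fderiv ℝ η x‖ ^ 2) := by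
    apply Continuous.integrable_of_hasCompactSupport
    · fun_prop
    · exact (hηc.fderiv ℝ).comp_left (g := fun t => ‖t‖ ^ 2) (by simp)
  have i3 : Integrable fun x => a x (fderiv ℝ v x) (fderiv ℝ (fun x => η x ^ 2) x) +
      η x ^ 2 * a x (fderiv ℝ v x) (fderiv ℝ v x) := by
    apply Continuous.integrable_of_hasCompactSupport
    · exact (ha.cont _ _ hvc' ((hη.pow 2).continuous_fderiv one_ne_zero)).add
        ((hηcc.pow 2).mul (ha.cont _ _ hvc' hvc'))
    · apply HasCompactSupport.add _ hη2c.mul_right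
      refine (hη2c.fderiv ℝ).mono ?_
      intro x hx hx'
      apply hx
      simp [hx']
  have hpt : ∀ x, l ^ 2 / 2 * (η x ^ 2 * ‖fderiv ℝ v x‖ ^ 2) - 2 * L ^ 2 * ‖fderiv ℝ η x‖ ^ 2 ≤
      l * (a x (fderiv ℝ v x) (fderiv ℝ (fun x => η x ^ 2) x) +
      η x ^ 2 * a x (fderiv ℝ v x) (fderiv ℝ v x)) := by
    intro x
    rw [hη2d x, map_smul, smul_eq_mul]
    have h1 := ha.coer x (fderiv ℝ v x)
    have h2 := (abs_le.1 (ha.bdd x (fderiv ℝ v x) (fderiv ℝ η x))).1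
    have h3 := hη0 x
    set X := ‖fderiv ℝ v x‖
    set Y := ‖fderiv ℝ η x‖
    have h4 : η x ^ 2 * (l * X ^ 2) ≤ η x ^ 2 * a x (fderiv ℝ v x) (fderiv ℝ v x) := by gcongr
    have h5 : 2 * η x * (-(L * X * Y)) ≤ 2 * η x * a x (fderiv ℝ v x) (fderiv ℝ η x) := by gcongr
    nlinarith [mul_le_mul_of_nonneg_left h4 hl.le, mul_le_mul_of_nonneg_left h5 hl.le,
      sq_nonneg (l * (η x * X) - 2 * L * Y)]
  have hm := integral_mono ((i1.const_mul _).sub (i2.const_mul _)) (i3.const_mul l) hpt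
  rw [integral_sub' (i1.const_mul _) (i2.const_mul _), integral_const_mul, integral_const_mul,
    integral_const_mul, key, mul_zero] at hm
  have g1 : ∫ x in ball y R, ‖fderiv ℝ v x‖ ^ 2 ≤ ∫ x, η x ^ 2 * ‖fderiv ℝ v x‖ ^ 2 := by
    have e : ∫ x in ball y R, ‖fderiv ℝ v x‖ ^ 2 =
        ∫ x in ball y R, η x ^ 2 * ‖fderiv ℝ v x‖ ^ 2 := by
      apply setIntegral_congr_fun measurableSet_ball
      intro x hx
      simp [hone x hx]
    rw [e]
    apply setIntegral_le_integral i1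
    exact Eventually.of_forall fun x => by positivity
  have g2 : ∫ x, ‖fderiv ℝ η x‖ ^ 2 ≤
      (C2 / R) ^ 2 * ((2 * R) ^ n * volume.real (ball (0 : En n) 1)) := by
    have e : ∫ x, ‖fderiv ℝ η x‖ ^ 2 = ∫ x in ball y (2 * R), ‖fderiv ℝ η x‖ ^ 2 := by
      symm
      apply setIntegral_eq_integral_of_forall_compl_eq_zero
      intro x hx
      rw [hdz x hx]
      simp
    rw [e, ← volume_ball_En y (by positivity)]
    calc ∫ x in ball y (2 * R), ‖fderiv ℝ η x‖ ^ 2 ≤ ∫ x in ball y (2 * R), (C2 / R) ^ 2 := by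
          apply setIntegral_mono_on i2.integrableOn
            (integrableOn_const measure_ball_lt_top.ne) measurableSet_ball
          intro x _
          have := hd x
          gcongr
      _ = _ := by rw [setIntegral_const, smul_eq_mul, mul_comm]
  set ω := volume.real (ball (0 : En n) 1) with hω
  set I := ∫ x in ball y R, ‖fderiv ℝ v x‖ ^ 2 with hI
  set J := ∫ x, ‖fderiv ℝ η x‖ ^ 2 with hJ
  have g3 : l ^ 2 * I ≤ 4 * L ^ 2 * J := by nlinarith [mul_le_mul_of_nonneg_left g1 (sq_nonneg l)]
  have g4 : I ≤ 4 * L ^ 2 / l ^ 2 * J := by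
    rw [div_mul_eq_mul_div, le_div_iff₀ (by positivity)]
    linarith
  calc R ^ 2 * I ≤ R ^ 2 * (4 * L ^ 2 / l ^ 2 * ((C2 / R) ^ 2 * ((2 * R) ^ n * ω))) := by
        gcongr
        exact g4.trans (by gcongr)
    _ = 4 * L ^ 2 / l ^ 2 * (C2 ^ 2 * (2 ^ n * ω)) * R ^ n := by
        rw [mul_pow]; field_simp
    _ ≤ _ := by
        gcongr
        linarith

/-- Growth lemma. -/
lemma growth {n : ℕ} (hn : 2 ≤ n)
    {a : En n → (En n →L[ℝ] ℝ) →ₗ[ℝ] (En n →L[ℝ] ℝ) →ₗ[ℝ] ℝ} {l L : ℝ}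
    (ha : UEll n a l L) (ε : ℝ) (hε : 0 < ε) : ∃ c : ℝ, 0 < c ∧ ∀ H : En n → ℝ,
    ContDiff ℝ 1 H → (∀ x, 0 < H x) → WSol n a H → ∀ (y : En n) (R t : ℝ), 0 < R → 0 < t →
    ε * R ^ n ≤ volume.real (ball y R ∩ {x | t ≤ H x}) →
    ∀ x ∈ ball y (R / 2), c * t ≤ H x := by
  obtain ⟨C, hC, LE⟩ := log_energy ha
  obtain ⟨ε₀, hε₀, LM⟩ := local_max hn ha
  set ω := volume.real (ball (0 : En n) 1) with hω
  have hω0 : 0 ≤ ω := measureReal_nonneg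
  set M := 4 * (2 ^ n * ω) * C / ε with hM
  have hM0 : 0 ≤ M := by positivity
  set k := √(M / ε₀) + 1 with hk
  have hk0 : 0 < k := by positivity
  have hkM : M ≤ ε₀ * k ^ 2 := by
    have h1 : √(M / ε₀) ^ 2 = M / ε₀ := Real.sq_sqrt (by positivity)
    have h2 : M / ε₀ ≤ k ^ 2 := by
      rw [hk]; nlinarith [Real.sqrt_nonneg (M / ε₀)]
    rwa [div_le_iff₀' hε₀] at h2
  refine ⟨Real.exp (-k), Real.exp_pos _, ?_⟩
  intro H hH hpos hsol y R t hR ht hvol x hx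
  set v : En n → ℝ := fun x => Real.log t - Real.log (H x) with hv
  have hvC : ContDiff ℝ 1 v := contDiff_const.sub (hH.log fun x => (hpos x).ne')
  have hsub : WSub n a v := log_sub ha hH hpos hsol _ hv
  have e1 := LE H hH hpos hsol (Real.log t) y R hR
  have e2 := poincare hvC y hR (ball y R ∩ {x | t ≤ H x})
    (measurableSet_ball.inter (isClosed_le continuous_const hH.continuous).measurableSet)
    inter_subset_left (by
      rintro z ⟨_, hz⟩
      have := Real.log_le_log ht hz
      simp only [hv]
      linarith)
  rw [volume_ball_En y hR] at e2
  have e3 : ∫ x in ball y R, max (v x) 0 ^ 2 ≤ M * R ^ n := by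
    set I := ∫ x in ball y R, max (v x) 0 ^ 2 with hI
    have hI0 : 0 ≤ I := setIntegral_nonneg measurableSet_ball fun x _ => sq_nonneg _
    set J := ∫ x in ball y R, ‖fderiv ℝ v x‖ ^ 2 with hJ
    have h1 : ε * R ^ n * I ≤ ε * R ^ n * (M * R ^ n) := by
      calc ε * R ^ n * I ≤ volume.real (ball y R ∩ {x | t ≤ H x}) * I := by gcongr
        _ ≤ _ := e2
        _ = 4 * (2 ^ n * (R ^ n * ω)) * (R ^ 2 * J) := by ring
        _ ≤ 4 * (2 ^ n * (R ^ n * ω)) * (C * R ^ n) := by gcongr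
        _ = _ := by rw [hM]; field_simp
    exact le_of_mul_le_mul_left h1 (by positivity)
  have e4 := LM v hvC hsub y R k hR hk0 (e3.trans (by
    calc M * R ^ n ≤ (ε₀ * k ^ 2) * R ^ n := by gcongr
      _ = _ := by ring)) x hx
  simp only [hv] at e4
  have h5 : Real.log t - k ≤ Real.log (H x) := by linarith
  have h6 := Real.exp_le_exp.2 h5
  rw [Real.exp_log (hpos x), sub_eq_add_neg, Real.exp_add, Real.exp_log ht] at h6
  linarith



/-- Global Harnack inequality for positive entire solutions. -/
lemma harnack {n : ℕ} (hn : 2 ≤ n)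
    {a : En n → (En n →L[ℝ] ℝ) →ₗ[ℝ] (En n →L[ℝ] ℝ) →ₗ[ℝ] ℝ} {l L : ℝ}
    (ha : UEll n a l L) : ∃ κ : ℝ, 0 < κ ∧ ∀ H : En n → ℝ,
    ContDiff ℝ 1 H → (∀ x, 0 < H x) → WSol n a H → ∀ x₀ x, κ * H x₀ ≤ H x := by
  set ω := volume.real (ball (0 : En n) 1) with hω
  have hω0 : 0 < ω := by
    rw [hω, Measure.real]
    exact ENNReal.toReal_pos (measure_ball_pos volume _ one_pos).ne' measure_ball_lt_top.ne
  obtain ⟨c1, hc1, G1⟩ := growth hn ha (ω / 4 ^ n) (by positivity)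
  obtain ⟨ε₀, hε₀, LM⟩ := local_max hn ha
  obtain ⟨β', hβ'⟩ := exists_pow_lt_of_lt_one hc1 (by norm_num : (1 / 2 : ℝ) < 1)
  set β := β' + 1 with hβ
  set d : ℝ := (1 / 2) ^ β with hd
  have hd0 : 0 < d := by positivity
  have hdc : d ≤ c1 := by
    refine le_trans ?_ hβ'.le
    rw [hd, hβ, pow_succ]
    have : (0 : ℝ) < (1 / 2) ^ β' := by positivity
    linarith
  obtain ⟨c2, hc2, G2⟩ := growth hn ha (ε₀ / 16 / (2 ^ β) ^ 2) (by positivity)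
  refine ⟨c2 / 2 / 16 ^ β, by positivity, ?_⟩
  intro H hH hpos hsol x₀ x
  have hHc := hH.continuous
  -- expansion of positivity
  have double : ∀ (y : En n) (r t : ℝ), 0 < r → 0 < t → (∀ z ∈ ball y r, t ≤ H z) →
      ∀ z ∈ ball y (2 * r), d * t ≤ H z := by
    intro y r t hr ht h z hz
    have h1 := G1 H hH hpos hsol y (4 * r) t (by positivity) ht (by
      have : ball y r ⊆ ball y (4 * r) ∩ {x | t ≤ H x} := fun z hz =>
        ⟨ball_subset_ball (by linarith) hz, h z hz⟩
      calc ω / 4 ^ n * (4 * r) ^ n = r ^ n * ω := by rw [mul_pow]; field_simp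
        _ = volume.real (ball y r) := (volume_ball_En y hr).symm
        _ ≤ _ := measureReal_mono this
          ((measure_mono inter_subset_left).trans_lt measure_ball_lt_top).ne) z
      (by convert hz using 2; ring)
    exact le_trans (by gcongr) h1
  have doubles : ∀ (y : En n) (r t : ℝ), 0 < r → 0 < t → (∀ z ∈ ball y r, t ≤ H z) →
      ∀ j : ℕ, ∀ z ∈ ball y (2 ^ j * r), d ^ j * t ≤ H z := by
    intro y r t hr ht h j
    induction j with
    | zero => simpa using h
    | succ j ih =>
      intro z hz
      have := double y (2 ^ j * r) (d ^ j * t) (by positivity) (by positivity) ih z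
        (by convert hz using 2; ring)
      rw [pow_succ]
      linarith
  set R := dist x x₀ + 1 with hR
  have hR0 : 0 < R := by positivity
  obtain ⟨y, hyB, hymax⟩ := (isCompact_closedBall x₀ R).exists_isMaxOn
    ⟨x₀, mem_closedBall_self hR0.le⟩
    (f := fun z => (R - dist z x₀) ^ β * H z) (by fun_prop)
  have hmax : ∀ z ∈ closedBall x₀ R, (R - dist z x₀) ^ β * H z ≤ (R - dist y x₀) ^ β * H y :=
    fun z hz => hymax hz
  have h0 := hmax x₀ (mem_closedBall_self hR0.le)
  rw [dist_self, sub_zero] at h0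
  have hHx₀ := hpos x₀
  have hHy := hpos y
  have hyR : dist y x₀ < R := by
    rcases (mem_closedBall.1 hyB).lt_or_eq with h | h
    · exact h
    · rw [h, sub_self, zero_pow (by omega), zero_mul] at h0
      have : 0 < R ^ β * H x₀ := by positivity
      linarith
  set r := (R - dist y x₀) / 2 with hr
  have hr0 : 0 < r := by rw [hr]; linarith
  have h2r : R - dist y x₀ = 2 * r := by rw [hr]; ring
  rw [h2r] at h0 hmax
  have hup : ∀ z ∈ ball y r, H z ≤ 2 ^ β * H y := by
    intro z hz
    have h1 : dist z x₀ < dist y x₀ + r := by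
      have := dist_triangle z y x₀
      have h2 : dist z y < r := hz
      linarith
    have h2 : r ≤ R - dist z x₀ := by linarith
    have h3 := hmax z (by rw [mem_closedBall]; linarith)
    have hHz := hpos z
    have h4 : r ^ β * H z ≤ r ^ β * (2 ^ β * H y) := by
      calc r ^ β * H z ≤ (R - dist z x₀) ^ β * H z := by gcongr
        _ ≤ _ := h3
        _ = _ := by rw [mul_pow]; ring
    exact le_of_mul_le_mul_left h4 (by positivity)
  -- measure estimate
  set v : En n → ℝ := fun z => H z - H y / 2 with hv
  have hvC : ContDiff ℝ 1 v := hH.sub contDiff_const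
  have hvd : ∀ z, fderiv ℝ v z = fderiv ℝ H z := fun z => by rw [hv, fderiv_sub_const]
  have hvsub : WSub n a v := by
    intro φ hφ hφc _
    simp only [hvd]
    exact (hsol φ hφ hφc).le
  set S := ball y r ∩ {z | H y / 2 ≤ H z} with hS
  have hSm : MeasurableSet S :=
    measurableSet_ball.inter (isClosed_le continuous_const hHc).measurableSet
  have hSf : volume S ≠ ∞ := ((measure_mono inter_subset_left).trans_lt measure_ball_lt_top).ne
  have hm : ε₀ / 16 / (2 ^ β) ^ 2 * r ^ n ≤ volume.real S := by
    have h1 : ε₀ * r ^ n * (H y / 4) ^ 2 < ∫ z in ball y r, max (v z) 0 ^ 2 := by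
      by_contra hcon
      have := LM v hvC hvsub y r (H y / 4) hr0 (by positivity) (not_lt.1 hcon) y
        (mem_ball_self (by positivity))
      simp only [hv] at this
      linarith
    have h2 : ∫ z in ball y r, max (v z) 0 ^ 2 = ∫ z in S, max (v z) 0 ^ 2 := by
      apply setIntegral_eq_of_subset_of_forall_sdiff_eq_zero measurableSet_ball inter_subset_left
      rintro z ⟨hz1, hz2⟩
      have : H z < H y / 2 := by
        by_contra h
        exact hz2 ⟨hz1, not_lt.1 h⟩
      simp only [hv]
      rw [max_eq_right (by linarith)]
      simp
    have h3 : ∫ z in S, max (v z) 0 ^ 2 ≤ ∫ z in S, (2 ^ β * H y) ^ 2 := by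
      have hvc := hvC.continuous
      apply setIntegral_mono_on
        ((integrableOn_ball (by fun_prop) y r).mono_set inter_subset_left)
        (integrableOn_const hSf) hSm
      intro z hz
      have h4 := hup z hz.1
      have h5 : max (v z) 0 ≤ 2 ^ β * H y := by
        apply max_le _ (by positivity)
        simp only [hv]; linarith
      gcongr
    rw [setIntegral_const, smul_eq_mul] at h3
    rw [h2] at h1
    have h6 : ε₀ * r ^ n * (H y / 4) ^ 2 < volume.real S * (2 ^ β * H y) ^ 2 := h1.trans_le h3
    have h7 : (ε₀ / 16 / (2 ^ β) ^ 2 * r ^ n) * (2 ^ β * H y) ^ 2 = ε₀ * r ^ n * (H y / 4) ^ 2 := by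
      field_simp
      norm_num
    rw [← h7] at h6
    exact (lt_of_mul_lt_mul_right h6 (by positivity)).le
  have hlow := G2 H hH hpos hsol y r (H y / 2) hr0 (by positivity) hm
  have hfin := doubles y (r / 2) (c2 * (H y / 2)) (by positivity) (by positivity) hlow
  obtain ⟨m, hm1, hm2⟩ := exists_nat_pow_near (x := 4 * R / r) (y := 2) (by
    rw [le_div_iff₀ hr0]
    have : 0 ≤ dist y x₀ := dist_nonneg
    rw [hr]; linarith) (by norm_num)
  have hx := hfin (m + 1) x (by
    rw [mem_ball]
    have h1 : dist x y ≤ dist x x₀ + dist y x₀ := dist_triangle_right x y x₀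
    rw [div_lt_iff₀ hr0] at hm2
    have h2 : dist x x₀ < R := by rw [hR]; linarith
    linarith)
  refine le_trans ?_ hx
  have hj : (2 : ℝ) ^ (m + 1) ≤ 8 * R / r := by
    rw [pow_succ]
    calc (2 : ℝ) ^ m * 2 ≤ 4 * R / r * 2 := by gcongr
      _ = _ := by ring
  have hdj : (r / (8 * R)) ^ β ≤ d ^ (m + 1) := by
    rw [hd, ← pow_mul, mul_comm β (m + 1), pow_mul]
    gcongr
    rw [one_div, inv_pow, ← inv_div]
    gcongr
  have e1 : H x₀ / 16 ^ β ≤ (r / (8 * R)) ^ β * H y := by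
    rw [div_pow, mul_pow, div_mul_eq_mul_div, div_le_div_iff₀ (by positivity) (by positivity)]
    rw [mul_pow] at h0
    have e16 : (16 : ℝ) ^ β = 8 ^ β * 2 ^ β := by rw [← mul_pow]; norm_num
    rw [e16]
    have : (0 : ℝ) < 8 ^ β := by positivity
    nlinarith
  calc c2 / 2 / 16 ^ β * H x₀ = c2 / 2 * (H x₀ / 16 ^ β) := by ring
    _ ≤ c2 / 2 * ((r / (8 * R)) ^ β * H y) := by gcongr
    _ ≤ c2 / 2 * (d ^ (m + 1) * H y) := by gcongr
    _ = _ := by ring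

/-- Liouville theorem for entire solutions bounded from below. -/
lemma liouville {n : ℕ} (hn : 2 ≤ n)
    {a : En n → (En n →L[ℝ] ℝ) →ₗ[ℝ] (En n →L[ℝ] ℝ) →ₗ[ℝ] ℝ} {l L : ℝ}
    (ha : UEll n a l L) {h : En n → ℝ} (hh : ContDiff ℝ 1 h) (hsol : WSol n a h)
    (m : ℝ) (hm : ∀ x, m ≤ h x) : ∀ x y, h x = h y := by
  obtain ⟨κ, hκ, HK⟩ := harnack hn ha
  have hbdd : BddBelow (range h) := ⟨m, by rintro _ ⟨x, rfl⟩; exact hm x⟩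
  set i := ⨅ x, h x with hi
  have hle : ∀ x, i ≤ h x := fun x => ciInf_le hbdd x
  have main : ∀ x, h x ≤ i := by
    intro x
    have key : ∀ ε : ℝ, 0 < ε → κ * (h x - i) ≤ ε := by
      intro ε hε
      obtain ⟨z, hz⟩ : ∃ z, h z < i + ε / 2 := exists_lt_of_ciInf_lt (by linarith)
      have := HK (fun x => h x - i + ε / 2) ((hh.sub contDiff_const).add contDiff_const)
        (fun x => by have := hle x; linarith) (by
          intro φ hφ hφc
          have : ∀ x, fderiv ℝ (fun x => h x - i + ε / 2) x = fderiv ℝ h x := fun x => by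
            rw [fderiv_add_const, fderiv_sub_const]
          simp only [this]
          exact hsol φ hφ hφc) x z
      nlinarith
    have : κ * (h x - i) ≤ 0 := le_of_forall_pos_le_add fun ε hε => by simpa using key ε hε
    nlinarith
  intro x y
  rw [le_antisymm (main x) (hle x), le_antisymm (main y) (hle y)]



/-- Simultaneous diagonalization bookkeeping for the determinants. -/
lemma exists_eigs {n : ℕ} {A : Matrix (Fin n) (Fin n) ℝ} {M : ℝ}
    (hA : A.IsHermitian) (hM : (A - M • (1 : Matrix (Fin n) (Fin n) ℝ)).PosSemidef) (K : ℝ) :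
    ∃ e : Fin n → ℝ, (∀ i, M ≤ e i) ∧
      (A + K • (1 : Matrix (Fin n) (Fin n) ℝ)).det = ∏ i, (e i + K) ∧
      (1 + A * A).det = ∏ i, (1 + e i ^ 2) := by
  set U : Matrix (Fin n) (Fin n) ℝ := hA.eigenvectorUnitary.1 with hU
  have h1 : U * star U = 1 := Unitary.coe_mul_star_self hA.eigenvectorUnitary
  have h2 : star U * U = 1 := Unitary.coe_star_mul_self hA.eigenvectorUnitary
  set D : Matrix (Fin n) (Fin n) ℝ := diagonal hA.eigenvalues with hD
  have h3 : A = U * D * star U := by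
    conv_lhs => rw [hA.spectral_theorem]
    rw [Unitary.conjStarAlgAut_apply]
    rfl
  have hdet : ∀ B : Matrix (Fin n) (Fin n) ℝ, (U * B * star U).det = B.det := by
    intro B
    rw [det_mul, det_mul, mul_right_comm, ← det_mul, h1, det_one, one_mul]
  refine ⟨hA.eigenvalues, ?_, ?_, ?_⟩
  · intro i
    have h4 := hM.dotProduct_mulVec_nonneg (hA.eigenvectorBasis i)
    have h5 := hA.eigenvalues_eq i
    have h6 : (star ⇑(hA.eigenvectorBasis i) : Fin n → ℝ) ⬝ᵥ ⇑(hA.eigenvectorBasis i) = 1 := by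
      have := hA.eigenvectorBasis.orthonormal.1 i
      have h7 := real_inner_self_eq_norm_sq (hA.eigenvectorBasis i)
      rw [this, EuclideanSpace.inner_eq_star_dotProduct, dotProduct_comm] at h7
      simpa using h7
    rw [sub_mulVec, dotProduct_sub, smul_mulVec, one_mulVec, dotProduct_smul, h6] at h4
    simp at h5 h4
    linarith
  · have : A + K • (1 : Matrix (Fin n) (Fin n) ℝ) =
        U * (diagonal fun i => hA.eigenvalues i + K) * star U := by
      have e : (diagonal fun i => hA.eigenvalues i + K) = D + K • (1 : Matrix (Fin n) (Fin n) ℝ) := by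
        rw [hD, ← diagonal_one, ← diagonal_smul, diagonal_add]
        congr 1; ext i; simp
      rw [e, mul_add, add_mul, ← h3, Matrix.mul_smul, mul_one, Matrix.smul_mul, h1]
    rw [this, hdet, det_diagonal]
  · have : 1 + A * A = U * (diagonal fun i => 1 + hA.eigenvalues i ^ 2) * star U := by
      have e : (diagonal fun i => 1 + hA.eigenvalues i ^ 2) = 1 + D * D := by
        rw [hD, diagonal_mul_diagonal, ← diagonal_one, diagonal_add]
        congr 1; ext i; ring
      have e2 : A * A = U * (D * D) * star U := by
        conv_lhs => rw [h3]
        calc U * D * star U * (U * D * star U) = U * D * (star U * U) * D * star U := by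
              simp only [mul_assoc]
          _ = _ := by rw [h2]; simp only [mul_assoc, mul_one]
      rw [e, mul_add, add_mul, mul_one, h1, e2]
    rw [this, hdet, det_diagonal]

lemma det_P_pos {n : ℕ} {A : Matrix (Fin n) (Fin n) ℝ} {M : ℝ}
    (hA : A.IsHermitian) (hM : (A - M • (1 : Matrix (Fin n) (Fin n) ℝ)).PosSemidef) :
    0 < (A + (|M| + 1) • (1 : Matrix (Fin n) (Fin n) ℝ)).det := by
  obtain ⟨e, he, h1, h2⟩ := exists_eigs hA hM (|M| + 1)
  rw [h1]
  refine Finset.prod_pos fun i _ => ?_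
  have := he i
  have := neg_abs_le M
  linarith

lemma det_g_pos {n : ℕ} {A : Matrix (Fin n) (Fin n) ℝ} {M : ℝ}
    (hA : A.IsHermitian) (hM : (A - M • (1 : Matrix (Fin n) (Fin n) ℝ)).PosSemidef) :
    0 < (1 + A * A).det := by
  obtain ⟨e, he, h1, h2⟩ := exists_eigs hA hM (|M| + 1)
  rw [h2]
  exact Finset.prod_pos fun i _ => by positivity

lemma rho_bounds {n : ℕ} {A : Matrix (Fin n) (Fin n) ℝ} {M : ℝ}
    (hA : A.IsHermitian) (hM : (A - M • (1 : Matrix (Fin n) (Fin n) ℝ)).PosSemidef) :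
    √((1 / (2 * (|M| + 1) ^ 2)) ^ n) ≤
      √(1 + A * A).det / (A + (|M| + 1) • (1 : Matrix (Fin n) (Fin n) ℝ)).det ∧
    √(1 + A * A).det / (A + (|M| + 1) • (1 : Matrix (Fin n) (Fin n) ℝ)).det ≤
      √((3 + 2 * (|M| + 1) ^ 2) ^ n) := by
  have hpos := det_P_pos hA hM
  obtain ⟨e, he, h1, h2⟩ := exists_eigs hA hM (|M| + 1)
  set K := |M| + 1 with hK
  have hK1 : 1 ≤ K := by rw [hK]; linarith [abs_nonneg M]
  have hMK : 1 ≤ M + K := by rw [hK]; linarith [neg_abs_le M]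
  rw [le_div_iff₀ hpos, div_le_iff₀ hpos]
  have hs : (A + K • (1 : Matrix (Fin n) (Fin n) ℝ)).det = √((∏ i, (e i + K)) ^ 2) := by
    rw [← h1, Real.sqrt_sq hpos.le]
  rw [hs, ← Real.sqrt_mul (by positivity), ← Real.sqrt_mul (by positivity), h2, ← Finset.prod_pow]
  have hc : ∀ c : ℝ, c ^ n = ∏ _i : Fin n, c := fun c => by simp
  rw [hc, hc, ← Finset.prod_mul_distrib, ← Finset.prod_mul_distrib]
  constructor
  · apply Real.sqrt_le_sqrt
    apply Finset.prod_le_prod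
    · intro i _; positivity
    · intro i _
      rw [one_div, inv_mul_le_iff₀ (by positivity)]
      nlinarith [sq_nonneg (e i - K), sq_nonneg (e i), mul_nonneg (sq_nonneg (e i)) (by nlinarith : 0 ≤ K ^ 2 - 1)]
  · apply Real.sqrt_le_sqrt
    apply Finset.prod_le_prod
    · intro i _; positivity
    · intro i _
      have h3 : 1 ≤ e i + K := by linarith [he i]
      have h4 : 1 ≤ (e i + K) ^ 2 := by nlinarith
      nlinarith [sq_nonneg (e i + K + K), sq_nonneg (e i + 2 * K), mul_nonneg (sq_nonneg K) (by linarith : 0 ≤ (e i + K) ^ 2 - 1)]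

lemma symm_dot {n : ℕ} {A : Matrix (Fin n) (Fin n) ℝ} (hA : A.IsHermitian) (v w : Fin n → ℝ) :
    v ⬝ᵥ A *ᵥ w = A *ᵥ v ⬝ᵥ w := by
  rw [dotProduct_mulVec, ← mulVec_transpose]
  congr 2

lemma dot_cs {n : ℕ} (v w : Fin n → ℝ) : (v ⬝ᵥ w) ^ 2 ≤ (v ⬝ᵥ v) * (w ⬝ᵥ w) := by
  have := Finset.sum_mul_sq_le_sq_mul_sq Finset.univ v w
  simpa [dotProduct, sq] using this

lemma dot_self_nonneg {n : ℕ} (v : Fin n → ℝ) : 0 ≤ v ⬝ᵥ v :=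
  Finset.sum_nonneg fun i _ => mul_self_nonneg _

/-- Bounds for the conjugated inverse metric. -/
lemma PgP_bounds {n : ℕ} {A : Matrix (Fin n) (Fin n) ℝ} {M : ℝ}
    (hA : A.IsHermitian) (hM : (A - M • (1 : Matrix (Fin n) (Fin n) ℝ)).PosSemidef)
    (p q : Fin n → ℝ) :
    (p ⬝ᵥ ((A + (|M| + 1) • (1 : Matrix (Fin n) (Fin n) ℝ)) * (1 + A * A)⁻¹ *
      (A + (|M| + 1) • (1 : Matrix (Fin n) (Fin n) ℝ))) *ᵥ q) ^ 2 ≤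
        (2 * (|M| + 1) ^ 2) ^ 2 * ((p ⬝ᵥ p) * (q ⬝ᵥ q)) ∧
    1 / (3 + 2 * (|M| + 1) ^ 2) * (p ⬝ᵥ p) ≤
    (p ⬝ᵥ ((A + (|M| + 1) • (1 : Matrix (Fin n) (Fin n) ℝ)) * (1 + A * A)⁻¹ *
      (A + (|M| + 1) • (1 : Matrix (Fin n) (Fin n) ℝ))) *ᵥ p) := by
  have hdg := det_g_pos hA hM
  have hdP := det_P_pos hA hM
  set K := |M| + 1 with hK
  have hK1 : 1 ≤ K := by rw [hK]; linarith [abs_nonneg M]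
  have hMK : 1 ≤ M + K := by rw [hK]; linarith [neg_abs_le M]
  set P := A + K • (1 : Matrix (Fin n) (Fin n) ℝ) with hP
  set g := 1 + A * A with hg
  have hPs : P.IsHermitian := by
    rw [hP]; apply hA.add
    simp [Matrix.IsHermitian]
  have hgg : ∀ v, g *ᵥ (g⁻¹ *ᵥ v) = v := fun v => by
    rw [mulVec_mulVec, Matrix.mul_nonsing_inv _ (isUnit_iff_ne_zero.2 hdg.ne'), one_mulVec]
  have hPP : ∀ v, P *ᵥ (P⁻¹ *ᵥ v) = v := fun v => by
    rw [mulVec_mulVec, Matrix.mul_nonsing_inv _ (isUnit_iff_ne_zero.2 hdP.ne'), one_mulVec]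
  have hgv : ∀ v w : Fin n → ℝ, v ⬝ᵥ g *ᵥ w = v ⬝ᵥ w + A *ᵥ v ⬝ᵥ A *ᵥ w := fun v w => by
    rw [hg, add_mulVec, one_mulVec, dotProduct_add, ← mulVec_mulVec, symm_dot hA]
  have hPv : ∀ v : Fin n → ℝ, P *ᵥ v = A *ᵥ v + K • v := fun v => by
    rw [hP, add_mulVec, smul_mulVec, one_mulVec]
  have hPn : ∀ v : Fin n → ℝ, P *ᵥ v ⬝ᵥ P *ᵥ v =
      A *ᵥ v ⬝ᵥ A *ᵥ v + 2 * K * (v ⬝ᵥ A *ᵥ v) + K ^ 2 * (v ⬝ᵥ v) := fun v => by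
    rw [hPv]
    simp only [add_dotProduct, dotProduct_add, smul_dotProduct, dotProduct_smul, smul_eq_mul]
    rw [dotProduct_comm (A *ᵥ v) v]; ring
  have hup : ∀ v : Fin n → ℝ, P *ᵥ v ⬝ᵥ P *ᵥ v ≤ 2 * K ^ 2 * (v ⬝ᵥ g *ᵥ v) := by
    intro v
    have h := dot_self_nonneg (A *ᵥ v - K • v)
    simp only [sub_dotProduct, dotProduct_sub, smul_dotProduct, dotProduct_smul, smul_eq_mul] at h
    rw [dotProduct_comm (A *ᵥ v) v] at h
    rw [hPn, hgv]
    have h2 := mul_nonneg (dot_self_nonneg (A *ᵥ v)) (by nlinarith : 0 ≤ K ^ 2 - 1)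
    nlinarith
  have hPP1 : ∀ v : Fin n → ℝ, v ⬝ᵥ v ≤ P *ᵥ v ⬝ᵥ P *ᵥ v := by
    intro v
    have h1 := hM.dotProduct_mulVec_nonneg v
    rw [sub_mulVec, dotProduct_sub, smul_mulVec, one_mulVec, dotProduct_smul] at h1
    simp only [star_trivial, smul_eq_mul] at h1
    have h2 : v ⬝ᵥ v ≤ v ⬝ᵥ P *ᵥ v := by
      rw [hPv, dotProduct_add, dotProduct_smul, smul_eq_mul]
      nlinarith [dot_self_nonneg v]
    have h3 := dot_self_nonneg (P *ᵥ v - v)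
    simp only [sub_dotProduct, dotProduct_sub] at h3
    rw [dotProduct_comm (P *ᵥ v) v] at h3
    linarith
  have hlo : ∀ v : Fin n → ℝ, v ⬝ᵥ g *ᵥ v ≤ (3 + 2 * K ^ 2) * (P *ᵥ v ⬝ᵥ P *ᵥ v) := by
    intro v
    have h := dot_self_nonneg (A *ᵥ v + (2 * K) • v)
    simp only [add_dotProduct, dotProduct_add, smul_dotProduct, dotProduct_smul, smul_eq_mul] at h
    rw [dotProduct_comm (A *ᵥ v) v] at h
    have h1 := hPP1 v
    have h2 := mul_le_mul_of_nonneg_left h1 (by positivity : 0 ≤ 2 * K ^ 2 + 1)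
    rw [hgv]
    have := hPn v
    nlinarith [dot_self_nonneg v]
  have key : ∀ p q : Fin n → ℝ, p ⬝ᵥ (P * g⁻¹ * P) *ᵥ q = p ⬝ᵥ P *ᵥ (g⁻¹ *ᵥ (P *ᵥ q)) := by
    intro p q
    rw [← mulVec_mulVec, ← mulVec_mulVec]
  have hs : ∀ q : Fin n → ℝ, q ⬝ᵥ P *ᵥ (g⁻¹ *ᵥ (P *ᵥ q)) =
      (g⁻¹ *ᵥ (P *ᵥ q)) ⬝ᵥ g *ᵥ (g⁻¹ *ᵥ (P *ᵥ q)) := by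
    intro q
    rw [hgg, symm_dot hPs, dotProduct_comm]
  have hgnn : ∀ v : Fin n → ℝ, 0 ≤ v ⬝ᵥ g *ᵥ v := fun v => by
    rw [hgv]; exact add_nonneg (dot_self_nonneg _) (dot_self_nonneg _)
  have hsup : ∀ q : Fin n → ℝ, q ⬝ᵥ P *ᵥ (g⁻¹ *ᵥ (P *ᵥ q)) ≤ 2 * K ^ 2 * (q ⬝ᵥ q) := by
    intro q
    set w := g⁻¹ *ᵥ (P *ᵥ q) with hw
    have h1 := dot_cs q (P *ᵥ w)
    have h2 := hup w
    rw [← hs q] at h2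
    have h0 : 0 ≤ q ⬝ᵥ P *ᵥ w := by rw [hs q]; exact hgnn _
    rcases h0.eq_or_lt with h | h
    · rw [← h]; exact mul_nonneg (by positivity) (dot_self_nonneg _)
    · have h3 := mul_le_mul_of_nonneg_left h2 (dot_self_nonneg q)
      have h4 : (q ⬝ᵥ P *ᵥ w) * (q ⬝ᵥ P *ᵥ w) ≤ (2 * K ^ 2 * (q ⬝ᵥ q)) * (q ⬝ᵥ P *ᵥ w) := by
        nlinarith
      exact le_of_mul_le_mul_right h4 h
  constructor
  · rw [key]
    have h1 := dot_cs p (P *ᵥ (g⁻¹ *ᵥ (P *ᵥ q)))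
    have h2 := hup (g⁻¹ *ᵥ (P *ᵥ q))
    rw [← hs] at h2
    have h3 := hsup q
    have h4 := mul_le_mul_of_nonneg_left (h2.trans (mul_le_mul_of_nonneg_left h3
      (by positivity : 0 ≤ 2 * K ^ 2))) (dot_self_nonneg p)
    linarith
  · rw [key, one_div, inv_mul_le_iff₀ (by positivity)]
    set w := g⁻¹ *ᵥ (P *ᵥ p) with hw
    set z := P⁻¹ *ᵥ p with hz
    have hPz : P *ᵥ z = p := hPP p
    have h1 : p ⬝ᵥ p = w ⬝ᵥ g *ᵥ z := by
      have : w ⬝ᵥ g *ᵥ z = g *ᵥ w ⬝ᵥ z := by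
        apply symm_dot
        rw [hg]
        have := hA.eq
        simp [Matrix.IsHermitian, conjTranspose_mul] at this ⊢
        rw [this]
      rw [this, hgg, ← symm_dot hPs, hPz]
    have h2 : (w ⬝ᵥ g *ᵥ z) ^ 2 ≤ (w ⬝ᵥ g *ᵥ w) * (z ⬝ᵥ g *ᵥ z) := by
      have hq : ∀ t : ℝ, 0 ≤ (z ⬝ᵥ g *ᵥ z) * (t * t) + (2 * (w ⬝ᵥ g *ᵥ z)) * t + w ⬝ᵥ g *ᵥ w := by
        intro t
        have := hgnn (w + t • z)
        rw [hgv] at this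
        simp only [mulVec_add, mulVec_smul, add_dotProduct, dotProduct_add, smul_dotProduct,
          dotProduct_smul, smul_eq_mul] at this
        rw [hgv, hgv, hgv]
        rw [dotProduct_comm z w, dotProduct_comm (A *ᵥ z) (A *ᵥ w)] at this
        linarith
      have := discrim_le_zero hq
      rw [discrim] at this
      linarith
    have h3 := hlo z
    rw [hPz] at h3
    rw [← h1, ← hs p] at h2
    have h0 : 0 ≤ p ⬝ᵥ P *ᵥ w := by rw [hs p]; exact hgnn _
    have h4 := mul_le_mul_of_nonneg_left h3 h0
    rcases (dot_self_nonneg p).eq_or_lt with h | h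
    · rw [← h]; positivity
    · have h5 : (p ⬝ᵥ p) * (p ⬝ᵥ p) ≤ ((3 + 2 * K ^ 2) * (p ⬝ᵥ P *ᵥ w)) * (p ⬝ᵥ p) := by nlinarith
      exact le_of_mul_le_mul_right h5 h



/-- Components of a covector. -/
def cvec {n : ℕ} (p : En n →L[ℝ] ℝ) : Fin n → ℝ := fun i => p (EuclideanSpace.single i 1)

lemma cvec_apply {n : ℕ} (p : En n →L[ℝ] ℝ) (v : En n) : p v = cvec p ⬝ᵥ v := by
  have h := (EuclideanSpace.basisFun (Fin n) ℝ).sum_repr v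
  conv_lhs => rw [← h]
  rw [map_sum]
  simp [cvec, dotProduct, mul_comm]

lemma cvec_dot {n : ℕ} (p : En n →L[ℝ] ℝ) : cvec p ⬝ᵥ cvec p = ‖p‖ ^ 2 := by
  obtain ⟨v, rfl⟩ := (InnerProductSpace.toDual ℝ (En n)).surjective p
  rw [LinearIsometryEquiv.norm_map]
  have : cvec (InnerProductSpace.toDual ℝ (En n) v) = v := by
    ext i
    simp [cvec, EuclideanSpace.inner_single_right]
  rw [this, EuclideanSpace.norm_sq_eq]
  simp [dotProduct, sq]

/-- The bilinear form on covectors attached to a matrix field. -/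
def matForm {n : ℕ} (B : En n → Matrix (Fin n) (Fin n) ℝ) (x : En n) :
    (En n →L[ℝ] ℝ) →ₗ[ℝ] (En n →L[ℝ] ℝ) →ₗ[ℝ] ℝ :=
  LinearMap.mk₂ ℝ (fun p q => cvec p ⬝ᵥ B x *ᵥ cvec q)
    (fun p p' q => by
      have : cvec (p + p') = cvec p + cvec p' := by ext i; simp [cvec]
      rw [this, add_dotProduct])
    (fun c p q => by
      have : cvec (c • p) = c • cvec p := by ext i; simp [cvec]
      rw [this, smul_dotProduct])
    (fun p q q' => by
      have : cvec (q + q') = cvec q + cvec q' := by ext i; simp [cvec]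
      rw [this, mulVec_add, dotProduct_add])
    (fun c p q => by
      have : cvec (c • q) = c • cvec q := by ext i; simp [cvec]
      rw [this, mulVec_smul, dotProduct_smul])

lemma matForm_apply {n : ℕ} (B : En n → Matrix (Fin n) (Fin n) ℝ) (x : En n)
    (p q : En n →L[ℝ] ℝ) : matForm B x p q = cvec p ⬝ᵥ B x *ᵥ cvec q := rfl

lemma continuous_cvec {n : ℕ} {p : En n → (En n →L[ℝ] ℝ)} (hp : Continuous p) :
    Continuous fun x => cvec (p x) := by
  unfold cvec
  exact continuous_pi fun i => hp.clm_apply continuous_const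

lemma contDiff_det {n m : ℕ} {B : En n → Matrix (Fin m) (Fin m) ℝ}
    (hB : ∀ i j, ContDiff ℝ (⊤ : ℕ∞) fun x => B x i j) :
    ContDiff ℝ (⊤ : ℕ∞) fun x => (B x).det := by
  simp only [det_apply']
  exact ContDiff.sum fun σ _ => contDiff_const.mul (contDiff_prod fun i _ => hB _ _)

lemma contDiff_inv_entry {n m : ℕ} {B : En n → Matrix (Fin m) (Fin m) ℝ}
    (hB : ∀ i j, ContDiff ℝ (⊤ : ℕ∞) fun x => B x i j) (hd : ∀ x, (B x).det ≠ 0) (i j : Fin m) :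
    ContDiff ℝ (⊤ : ℕ∞) fun x => (B x)⁻¹ i j := by
  have : (fun x => (B x)⁻¹ i j) = fun x => ((B x).det)⁻¹ * ((B x).updateRow j (Pi.single i 1)).det := by
    ext x
    rw [inv_def, Matrix.smul_apply, adjugate_apply, Ring.inverse_eq_inv', smul_eq_mul]
  rw [this]
  refine ((contDiff_det hB).inv hd).mul (contDiff_det fun k l => ?_)
  by_cases h : k = j
  · subst h; simp only [updateRow_self]; exact contDiff_const
  · simp only [updateRow_ne h]; exact hB _ _

lemma contDiff_pdrv {n : ℕ} {f : En n → ℝ} (hf : ContDiff ℝ (⊤ : ℕ∞) f) (i : Fin n) :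
    ContDiff ℝ (⊤ : ℕ∞) (pdrv n i f) := by
  unfold pdrv
  exact (hf.fderiv_right (m := (⊤ : ℕ∞)) (by simp)).clm_apply contDiff_const

lemma contDiff_hess {n : ℕ} {u : En n → ℝ} (hu : ContDiff ℝ (⊤ : ℕ∞) u) (i j : Fin n) :
    ContDiff ℝ (⊤ : ℕ∞) fun x => hess n u x i j :=
  contDiff_pdrv (contDiff_pdrv hu i) j

lemma hess_herm {n : ℕ} {A : Matrix (Fin n) (Fin n) ℝ} {M : ℝ}
    (hM : (A - M • (1 : Matrix (Fin n) (Fin n) ℝ)).PosSemidef) : A.IsHermitian := by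
  have h := hM.1.add (show (M • (1 : Matrix (Fin n) (Fin n) ℝ)).IsHermitian by
    simp [Matrix.IsHermitian])
  simpa using h

/-- The shifted gradient map. -/
def gradMap (n : ℕ) (u : En n → ℝ) (K : ℝ) (x : En n) : En n :=
  WithLp.toLp 2 fun i => pdrv n i u x + K * x i

lemma contDiff_gradMap {n : ℕ} {u : En n → ℝ} (hu : ContDiff ℝ (⊤ : ℕ∞) u) (K : ℝ) :
    ContDiff ℝ (⊤ : ℕ∞) (gradMap n u K) := by
  rw [contDiff_euclidean]
  intro i
  have := contDiff_pdrv hu i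
  simp only [gradMap]
  fun_prop

lemma hasFDerivAt_gradMap {n : ℕ} {u : En n → ℝ} (hu : ContDiff ℝ (⊤ : ℕ∞) u) (K : ℝ) (x : En n) :
    HasFDerivAt (gradMap n u K) (toEuclideanCLM (n := Fin n) (𝕜 := ℝ)
      (hess n u x + K • (1 : Matrix (Fin n) (Fin n) ℝ))) x := by
  rw [← hasFDerivWithinAt_univ, hasFDerivWithinAt_euclidean]
  intro i
  rw [hasFDerivWithinAt_univ]
  have h1 : HasFDerivAt (pdrv n i u) (fderiv ℝ (pdrv n i u) x) x :=
    ((contDiff_pdrv hu i).differentiable (by simp) x).hasFDerivAt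
  have h2 : HasFDerivAt (fun x : En n => x i) (EuclideanSpace.proj i : En n →L[ℝ] ℝ) x :=
    (EuclideanSpace.proj i : En n →L[ℝ] ℝ).hasFDerivAt
  have h3 := h1.add (h2.const_mul K)
  refine h3.congr_fderiv ?_
  ext v
  rw [ContinuousLinearMap.add_apply, cvec_apply]
  simp [ofLp_toEuclideanCLM, add_mulVec, smul_mulVec]
  rfl

lemma det_toEuc {n : ℕ} (B : Matrix (Fin n) (Fin n) ℝ) :
    (toEuclideanCLM (n := Fin n) (𝕜 := ℝ) B).det = B.det := by
  rw [ContinuousLinearMap.det, coe_toEuclideanCLM_eq_toEuclideanLin, toEuclideanLin_eq_toLin,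
    LinearMap.det_toLin]

lemma gradMap_mono {n : ℕ} {u : En n → ℝ} (hu : ContDiff ℝ (⊤ : ℕ∞) u) {M : ℝ}
    (hM : ∀ x, (hess n u x - M • (1 : Matrix (Fin n) (Fin n) ℝ)).PosSemidef) (x y : En n) :
    ‖x - y‖ ≤ ‖gradMap n u (|M| + 1) x - gradMap n u (|M| + 1) y‖ := by
  set K := |M| + 1 with hK
  have hMK : 1 ≤ M + K := by rw [hK]; linarith [neg_abs_le M]
  set v := x - y with hv
  set f : ℝ → ℝ := fun t => inner ℝ v (gradMap n u K (y + t • v)) with hf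
  have hder : ∀ t, HasDerivAt f (inner ℝ v (toEuclideanCLM (n := Fin n) (𝕜 := ℝ)
      (hess n u (y + t • v) + K • (1 : Matrix (Fin n) (Fin n) ℝ)) v)) t := by
    intro t
    have h1 : HasDerivAt (fun t : ℝ => y + t • v) v t := by
      simpa using ((hasDerivAt_id t).smul_const v).const_add y
    have h2 := (hasFDerivAt_gradMap hu K (y + t • v)).comp_hasDerivAt t h1
    have h3 := (hasDerivAt_const t v).inner ℝ h2
    simpa using h3
  have hge : ∀ t : ℝ, ‖v‖ ^ 2 ≤ (inner ℝ v (toEuclideanCLM (n := Fin n) (𝕜 := ℝ)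
      (hess n u (y + t • v) + K • (1 : Matrix (Fin n) (Fin n) ℝ)) v) : ℝ) := by
    intro t
    rw [inner_toEuclideanCLM]
    have h1 := (hM (y + t • v)).dotProduct_mulVec_nonneg v
    rw [sub_mulVec, dotProduct_sub, smul_mulVec, one_mulVec, dotProduct_smul] at h1
    rw [add_mulVec, dotProduct_add, smul_mulVec, one_mulVec, dotProduct_smul]
    simp only [star_trivial, smul_eq_mul] at h1 ⊢
    have h2 : (v : Fin n → ℝ) ⬝ᵥ v = ‖v‖ ^ 2 := by
      rw [EuclideanSpace.norm_sq_eq]; simp [dotProduct, sq]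
    rw [h2] at h1 ⊢
    nlinarith [sq_nonneg ‖v‖]
  obtain ⟨c, _, hc⟩ := exists_hasDerivAt_eq_slope f _ (zero_lt_one)
    (fun t _ => (hder t).continuousAt.continuousWithinAt) (fun t _ => hder t)
  have h1 := hge c
  rw [hc] at h1
  have h2 : f 1 - f 0 = inner ℝ v (gradMap n u K x - gradMap n u K y) := by
    simp only [hf, one_smul, zero_smul, add_zero, inner_sub_right]
    rw [hv, add_sub_cancel]
  rw [sub_zero, div_one, h2] at h1
  have h3 := real_inner_le_norm v (gradMap n u K x - gradMap n u K y)
  rcases (norm_nonneg v).eq_or_lt with h | h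
  · rw [← h]; exact norm_nonneg _
  · have : ‖v‖ * ‖v‖ ≤ ‖v‖ * ‖gradMap n u K x - gradMap n u K y‖ := by
      rw [← sq]; exact h1.trans h3
    exact le_of_mul_le_mul_left this h

/-- The shifted gradient map is a diffeomorphism of `ℝⁿ`. -/
lemma exists_diffeo {n : ℕ} {u : En n → ℝ} (hu : ContDiff ℝ (⊤ : ℕ∞) u) {M : ℝ}
    (hM : ∀ x, (hess n u x - M • (1 : Matrix (Fin n) (Fin n) ℝ)).PosSemidef) :
    ∃ Φ : En n ≃ₜ En n, (∀ x, Φ x = gradMap n u (|M| + 1) x) ∧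
      ContDiff ℝ (⊤ : ℕ∞) (Φ.symm : En n → En n) := by
  set K := |M| + 1 with hK
  have hC := contDiff_gradMap hu K
  have hanti : AntilipschitzWith 1 (gradMap n u K) := by
    apply AntilipschitzWith.of_le_mul_dist
    intro x y
    rw [dist_eq_norm, dist_eq_norm, NNReal.coe_one, one_mul]
    exact gradMap_mono hu hM x y
  have hdet : ∀ x, (toEuclideanCLM (n := Fin n) (𝕜 := ℝ)
      (hess n u x + K • (1 : Matrix (Fin n) (Fin n) ℝ))).det ≠ 0 := fun x => by
    rw [det_toEuc]; exact (det_P_pos (hess_herm (hM x)) (hM x)).ne'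
  set f' : En n → (En n ≃L[ℝ] En n) := fun x =>
    ContinuousLinearMap.toContinuousLinearEquivOfDetNeZero _ (hdet x) with hf'
  have hder : ∀ x, HasFDerivAt (gradMap n u K) (f' x : En n →L[ℝ] En n) x := fun x => by
    rw [hf', ContinuousLinearMap.coe_toContinuousLinearEquivOfDetNeZero]
    exact hasFDerivAt_gradMap hu K x
  have hclosed : IsClosedMap (gradMap n u K) := by
    have : IsProperMap (gradMap n u K) := by
      rw [isProperMap_iff_tendsto_cocompact]
      refine ⟨hC.continuous, ?_⟩
      have := hanti.tendsto_cobounded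
      rwa [cobounded_eq_cocompact] at this
    exact this.isClosedMap
  have hopen : IsOpenMap (gradMap n u K) := by
    rw [isOpenMap_iff_nhds_le]
    intro x
    have hs : HasStrictFDerivAt (gradMap n u K) (f' x : En n →L[ℝ] En n) x :=
      hC.contDiffAt.hasStrictFDerivAt' (hder x) (by simp)
    exact hs.map_nhds_eq_of_equiv.ge
  have hsurj : Function.Surjective (gradMap n u K) := by
    rw [← range_eq_univ]
    exact IsClopen.eq_univ ⟨hclosed.isClosed_range, hopen.isOpen_range⟩ (range_nonempty _)
  refine ⟨(Equiv.ofBijective _ ⟨hanti.injective, hsurj⟩).toHomeomorphOfContinuousClosed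
    hC.continuous hclosed, fun x => rfl, ?_⟩
  exact Homeomorph.contDiff_symm _ (f₀' := f') hder hC



/-- Weak form of the Laplace–Beltrami equation. -/
lemma weak_form {n : ℕ} {g : En n → Matrix (Fin n) (Fin n) ℝ} {h : En n → ℝ}
    (hg : ∀ i j, ContDiff ℝ (⊤ : ℕ∞) fun x => g x i j) (hd : ∀ x, 0 < (g x).det)
    (hh : ContDiff ℝ (⊤ : ℕ∞) h) (hharm : ∀ x, lapBel n g h x = 0)
    {φ : En n → ℝ} (hφ : ContDiff ℝ 1 φ) (hφc : HasCompactSupport φ) :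
    ∫ x, √(g x).det * (cvec (fderiv ℝ h x) ⬝ᵥ (g x)⁻¹ *ᵥ cvec (fderiv ℝ φ x)) = 0 := by
  set W : Fin n → Fin n → En n → ℝ := fun i j y =>
    √(g y).det * (g y)⁻¹ i j * pdrv n i h y with hW
  have hWs : ∀ i j, ContDiff ℝ (⊤ : ℕ∞) (W i j) := fun i j =>
    (((contDiff_det hg).sqrt fun x => (hd x).ne').mul
      (contDiff_inv_entry hg (fun x => (hd x).ne') i j)).mul (contDiff_pdrv hh i)
  have hφ' : ∀ j, Continuous (pdrv n j φ) := fun j =>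
    (hφ.continuous_fderiv (by simp)).clm_apply continuous_const
  have hφ'c : ∀ j, HasCompactSupport (pdrv n j φ) := fun j =>
    hφc.fderiv_apply (𝕜 := ℝ) _
  have hIg1 : ∀ i j, Integrable fun x => W i j x * pdrv n j φ x := fun i j =>
    ((hWs i j).continuous.mul (hφ' j)).integrable_of_hasCompactSupport (hφ'c j).mul_left
  have hIg2 : ∀ i j, Integrable fun x => pdrv n j (W i j) x * φ x := fun i j =>
    ((contDiff_pdrv (hWs i j) j).continuous.mul hφ.continuous).integrable_of_hasCompactSupport
      hφc.mul_left
  have hIg3 : ∀ i j, Integrable fun x => W i j x * φ x := fun i j =>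
    ((hWs i j).continuous.mul hφ.continuous).integrable_of_hasCompactSupport hφc.mul_left
  have hparts : ∀ i j, ∫ x, W i j x * pdrv n j φ x = - ∫ x, pdrv n j (W i j) x * φ x :=
    fun i j => integral_mul_fderiv_eq_neg_fderiv_mul_of_integrable (hIg2 i j) (hIg1 i j)
      (hIg3 i j) (fun x _ => (hWs i j).differentiable (by simp) x)
      (fun x _ => hφ.differentiable (by simp) x)
  have e1 : ∀ x, √(g x).det * (cvec (fderiv ℝ h x) ⬝ᵥ (g x)⁻¹ *ᵥ cvec (fderiv ℝ φ x)) =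
      ∑ i, ∑ j, W i j x * pdrv n j φ x := by
    intro x
    simp only [dotProduct, mulVec, Finset.mul_sum]
    refine Finset.sum_congr rfl fun i _ => Finset.sum_congr rfl fun j _ => ?_
    simp only [hW, cvec, pdrv]
    ring
  simp only [e1]
  rw [integral_finsetSum _ fun i _ => integrable_finsetSum _ fun j _ => hIg1 i j]
  have e2 : ∀ i, ∫ x, ∑ j, W i j x * pdrv n j φ x = - ∫ x, ∑ j, pdrv n j (W i j) x * φ x := by
    intro i
    rw [integral_finsetSum _ fun j _ => hIg1 i j, integral_finsetSum _ fun j _ => hIg2 i j]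
    simp only [hparts, Finset.sum_neg_distrib]
  simp only [e2, Finset.sum_neg_distrib]
  rw [← integral_finsetSum _ fun i _ => integrable_finsetSum _ fun j _ => hIg2 i j]
  have e3 : ∀ x, ∑ i, ∑ j, pdrv n j (W i j) x * φ x = 0 := by
    intro x
    have := hharm x
    simp only [lapBel] at this
    simp only [← Finset.sum_mul]
    rw [this, zero_mul]
  simp [e3]

/-- Liouville theorem on the gradient graph in dimension at least two. -/
lemma graph_liouville {n : ℕ} (hn : 2 ≤ n) {u h : En n → ℝ} (hu : ContDiff ℝ (⊤ : ℕ∞) u) {M : ℝ}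
    (hM : ∀ x, (hess n u x - M • (1 : Matrix (Fin n) (Fin n) ℝ)).PosSemidef)
    (hh : ContDiff ℝ (⊤ : ℕ∞) h) (m : ℝ) (hm : ∀ x, m ≤ h x)
    (hharm : ∀ x, lapBel n (fun y => 1 + hess n u y * hess n u y) h x = 0) :
    ∀ x y, h x = h y := by
  obtain ⟨Φ, hΦ, hΦs⟩ := exists_diffeo hu hM
  have hH : ∀ x, (hess n u x).IsHermitian := fun x => hess_herm (hM x)
  set K := |M| + 1 with hK
  have hK1 : 1 ≤ K := by rw [hK]; linarith [abs_nonneg M]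
  set P : En n → Matrix (Fin n) (Fin n) ℝ := fun x =>
    hess n u x + K • (1 : Matrix (Fin n) (Fin n) ℝ) with hP
  set g : En n → Matrix (Fin n) (Fin n) ℝ := fun x => 1 + hess n u x * hess n u x with hg
  have hdP : ∀ x, 0 < (P x).det := fun x => det_P_pos (hH x) (hM x)
  have hdg : ∀ x, 0 < (g x).det := fun x => det_g_pos (hH x) (hM x)
  have hPsym : ∀ x, (P x).IsHermitian := fun x => by
    apply (hH x).add
    simp [Matrix.IsHermitian]
  have hPC : ∀ i j, ContDiff ℝ (⊤ : ℕ∞) fun x => P x i j := fun i j =>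
    (contDiff_hess hu i j).add contDiff_const
  have hgC : ∀ i j, ContDiff ℝ (⊤ : ℕ∞) fun x => g x i j := fun i j => by
    simp only [hg, Matrix.add_apply, Matrix.mul_apply]
    exact contDiff_const.add (ContDiff.sum fun k _ =>
      (contDiff_hess hu i k).mul (contDiff_hess hu k j))
  set ρ : En n → ℝ := fun x => √(g x).det / (P x).det with hρ
  set B : En n → Matrix (Fin n) (Fin n) ℝ := fun x => ρ x • (P x * (g x)⁻¹ * P x) with hB
  have hPc : Continuous P := continuous_matrix fun i j => (hPC i j).continuous
  have hgic : Continuous fun x => (g x)⁻¹ := continuous_matrix fun i j =>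
    (contDiff_inv_entry hgC (fun x => (hdg x).ne') i j).continuous
  have hρc : Continuous ρ := (Real.continuous_sqrt.comp (contDiff_det hgC).continuous).div
    (contDiff_det hPC).continuous fun x => (hdP x).ne'
  have hBc : Continuous B := hρc.smul ((hPc.mul hgic).mul hPc)
  set a := matForm fun y => B (Φ.symm y) with ha
  set l0 := √((1 / (2 * K ^ 2)) ^ n) with hl0
  set L0 := √((3 + 2 * K ^ 2) ^ n) with hL0
  have hl0p : 0 < l0 := Real.sqrt_pos.2 (by positivity)
  have hL0p : 0 < L0 := Real.sqrt_pos.2 (by positivity)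
  have hρb : ∀ x, l0 ≤ ρ x ∧ ρ x ≤ L0 := fun x => rho_bounds (hH x) (hM x)
  have hUE : UEll n a (l0 * (1 / (3 + 2 * K ^ 2))) (L0 * (2 * K ^ 2)) := by
    refine ⟨?_, by positivity, by positivity, ?_, ?_⟩
    · intro p q hp hq
      simp only [ha, matForm_apply]
      exact (continuous_cvec hp).dotProduct
        ((hBc.comp Φ.symm.continuous).matrix_mulVec (continuous_cvec hq))
    · intro y p q
      simp only [ha, matForm_apply, hB, smul_mulVec, dotProduct_smul, smul_eq_mul]
      obtain ⟨h1, -⟩ := PgP_bounds (hH (Φ.symm y)) (hM (Φ.symm y)) (cvec p) (cvec q)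
      obtain ⟨h2, h3⟩ := hρb (Φ.symm y)
      rw [cvec_dot, cvec_dot] at h1
      rw [abs_mul, abs_of_nonneg (hl0p.le.trans h2)]
      have h4 : |cvec p ⬝ᵥ (P (Φ.symm y) * (g (Φ.symm y))⁻¹ * P (Φ.symm y)) *ᵥ cvec q| ≤
          2 * K ^ 2 * (‖p‖ * ‖q‖) := by
        apply abs_le_of_sq_le_sq _ (by positivity)
        refine h1.trans (le_of_eq ?_)
        ring
      calc _ ≤ L0 * (2 * K ^ 2 * (‖p‖ * ‖q‖)) := by gcongr
        _ = _ := by ring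
    · intro y p
      simp only [ha, matForm_apply, hB, smul_mulVec, dotProduct_smul, smul_eq_mul]
      obtain ⟨-, h1⟩ := PgP_bounds (hH (Φ.symm y)) (hM (Φ.symm y)) (cvec p) (cvec p)
      obtain ⟨h2, h3⟩ := hρb (Φ.symm y)
      rw [cvec_dot] at h1
      rw [mul_assoc]
      exact mul_le_mul h2 h1 (by positivity) (hl0p.le.trans h2)
  have hder : ∀ x, HasFDerivAt Φ (toEuclideanCLM (n := Fin n) (𝕜 := ℝ) (P x)) x := fun x => by
    have := hasFDerivAt_gradMap hu K x
    rwa [show (Φ : En n → En n) = gradMap n u K from funext hΦ]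
  have hΦC : ContDiff ℝ (⊤ : ℕ∞) Φ := by
    rw [show (Φ : En n → En n) = gradMap n u K from funext hΦ]
    exact contDiff_gradMap hu K
  have hchain : ∀ (f : En n → ℝ), Differentiable ℝ f → ∀ x,
      cvec (fderiv ℝ (f ∘ Φ) x) = P x *ᵥ cvec (fderiv ℝ f (Φ x)) := by
    intro f hf x
    rw [((hf (Φ x)).hasFDerivAt.comp x (hder x)).fderiv]
    ext i
    simp only [cvec, ContinuousLinearMap.comp_apply]
    rw [cvec_apply, ofLp_toEuclideanCLM, symm_dot (hPsym x)]
    simp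
  set H : En n → ℝ := h ∘ Φ.symm with hHdef
  have hHC : ContDiff ℝ (⊤ : ℕ∞) H := hh.comp hΦs
  have hHΦ : H ∘ Φ = h := by ext x; simp [hHdef]
  have hsol : WSol n a H := by
    intro ψ hψ hψc
    have h1 := weak_form hgC hdg hh hharm (φ := ψ ∘ Φ)
      (hψ.comp (hΦC.of_le (by simp))) (hψc.comp_homeomorph Φ)
    have h2 := integral_image_eq_integral_abs_det_fderiv_smul volume MeasurableSet.univ
      (fun x _ => (hder x).hasFDerivWithinAt) Φ.injective.injOn
      (fun y => a y (fderiv ℝ H y) (fderiv ℝ ψ y))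
    rw [image_univ, Φ.surjective.range_eq, setIntegral_univ, setIntegral_univ] at h2
    rw [h2, ← h1]
    congr 1
    ext x
    rw [det_toEuc, abs_of_pos (hdP x)]
    simp only [ha, matForm_apply, Φ.symm_apply_apply, hB, smul_mulVec, dotProduct_smul,
      smul_eq_mul]
    conv_rhs => rw [← hHΦ]
    rw [hchain H (hHC.differentiable (by simp)), hchain ψ (hψ.differentiable (by simp))]
    rw [← mul_assoc]
    congr 1
    · simp only [hρ]; field_simp [(hdP x).ne']
    · rw [← symm_dot (hPsym x), mulVec_mulVec, mulVec_mulVec]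
  have hfin := liouville hn hUE (hHC.of_le (by simp)) hsol m (fun y => hm _)
  intro x y
  have := hfin (Φ x) (Φ y)
  simpa [hHdef] using this

/-- The one-dimensional case. -/
lemma graph_liouville_one {u h : En 1 → ℝ} (hu : ContDiff ℝ (⊤ : ℕ∞) u)
    (hh : ContDiff ℝ (⊤ : ℕ∞) h) (m : ℝ) (hm : ∀ x, m ≤ h x)
    (hharm : ∀ x, lapBel 1 (fun y => 1 + hess 1 u y * hess 1 u y) h x = 0) :
    ∀ x y, h x = h y := by
  set d : En 1 → ℝ := fun x => 1 + hess 1 u x 0 0 * hess 1 u x 0 0 with hd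
  have hd1 : ∀ x, 1 ≤ d x := fun x => by
    simp only [hd]; nlinarith [mul_self_nonneg (hess 1 u x 0 0)]
  have hdC : ContDiff ℝ (⊤ : ℕ∞) d :=
    contDiff_const.add ((contDiff_hess hu 0 0).mul (contDiff_hess hu 0 0))
  set W : En 1 → ℝ := fun y => √(d y) * (d y)⁻¹ * pdrv 1 0 h y with hW
  have hWC : ContDiff ℝ (⊤ : ℕ∞) W :=
    ((hdC.sqrt fun x => (by linarith [hd1 x] : d x ≠ 0)).mul
      (hdC.inv fun x => (by linarith [hd1 x] : d x ≠ 0))).mul (contDiff_pdrv hh 0)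
  have hg : ∀ y, (1 + hess 1 u y * hess 1 u y).det = d y := fun y => by
    simp [det_unique, Matrix.mul_apply, hd]
  have hgi : ∀ y, (1 + hess 1 u y * hess 1 u y)⁻¹ 0 0 = (d y)⁻¹ := fun y => by
    rw [inv_def, hg, Ring.inverse_eq_inv', adjugate_subsingleton]
    simp
  have hW0 : ∀ x, fderiv ℝ W x = 0 := by
    intro x
    have h1 := hharm x
    simp only [lapBel, Finset.univ_unique, Fin.default_eq_zero, Finset.sum_singleton, Fin.isValue,
      hg, hgi] at h1
    ext v
    rw [cvec_apply]
    simp only [dotProduct, Finset.univ_unique, Fin.default_eq_zero, Finset.sum_singleton]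
    rw [show cvec (fderiv ℝ W x) 0 = 0 from h1]
    simp
  set c := W 0 with hc
  have hWc : ∀ x, W x = c := fun x =>
    is_const_of_fderiv_eq_zero (hWC.differentiable (by simp)) hW0 x 0
  have hp : ∀ x, pdrv 1 0 h x = c * √(d x) := fun x => by
    rw [← hWc x]
    have hdp : 0 < d x := by linarith [hd1 x]
    have hs := Real.mul_self_sqrt hdp.le
    simp only [hW]
    calc pdrv 1 0 h x = (√(d x) * √(d x)) * (d x)⁻¹ * pdrv 1 0 h x := by
          rw [hs, mul_inv_cancel₀ hdp.ne', one_mul]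
      _ = _ := by ring
  have hc0 : c = 0 := by
    by_contra hne
    set e : En 1 := EuclideanSpace.single 0 1 with he
    set f : ℝ → ℝ := fun t => h ((-c * t) • e) + c ^ 2 * t with hf
    have hder : ∀ t, HasDerivAt f (-c * (c * √(d ((-c * t) • e))) + c ^ 2) t := by
      intro t
      have h1 : HasDerivAt (fun t : ℝ => (-c * t) • e) ((-c) • e) t := by
        simpa using ((hasDerivAt_id t).const_mul (-c)).smul_const e
      have h2 := ((hh.differentiable (by simp)) ((-c * t) • e)).hasFDerivAt.comp_hasDerivAt t h1
      have h3 := h2.add ((hasDerivAt_id t).const_mul (c ^ 2))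
      refine h3.congr_deriv ?_
      rw [map_smul, smul_eq_mul, mul_one, ← hp]
      rfl
    have hanti : Antitone f := by
      apply antitone_of_deriv_nonpos (fun t => (hder t).differentiableAt)
      intro t
      rw [(hder t).deriv]
      have : 1 ≤ √(d ((-c * t) • e)) := Real.one_le_sqrt.2 (hd1 _)
      nlinarith [sq_nonneg c]
    have hc2 : 0 < c ^ 2 := by positivity
    set T := (|f 0 - m| + 1) / c ^ 2 with hT
    have hT0 : 0 ≤ T := by positivity
    have h1 := hanti hT0
    have h2 : c ^ 2 * T = |f 0 - m| + 1 := by rw [hT]; field_simp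
    have h3 : f T = h ((-c * T) • e) + c ^ 2 * T := rfl
    have h4 := hm ((-c * T) • e)
    have h5 := le_abs_self (f 0 - m)
    linarith
  have hh0 : ∀ x, fderiv ℝ h x = 0 := by
    intro x
    ext v
    rw [cvec_apply]
    simp only [dotProduct, Finset.univ_unique, Fin.default_eq_zero, Finset.sum_singleton]
    rw [show cvec (fderiv ℝ h x) 0 = 0 by
      change pdrv 1 0 h x = 0
      rw [hp, hc0, zero_mul]]
    simp
  intro x y
  exact is_const_of_fderiv_eq_zero (hh.differentiable (by simp)) hh0 x y

end Helpers

/-- If `F` is an elliptic (monotone in the positive semidefinite order) functional on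
symmetric matrices, `u` is smooth and semiconvex, and `F(D²u)` is harmonic for the metric
`g = Iₙ + (D²u)²` induced on the gradient graph, then `F(D²u)` is constant. -/
theorem elliptic_functional_constant_on_gradient_graph
    (n : ℕ) (hn : 1 ≤ n)
    (F : Matrix (Fin n) (Fin n) ℝ → ℝ)
    (hF : ∀ A B : Matrix (Fin n) (Fin n) ℝ, A.IsHermitian → B.IsHermitian →
      (B - A).PosSemidef → F A ≤ F B)
    (u : En n → ℝ) (hu : ContDiff ℝ (⊤ : ℕ∞) u)
    (hsemi : ∃ M : ℝ, ∀ x,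
      (hess n u x - M • (1 : Matrix (Fin n) (Fin n) ℝ)).PosSemidef)
    (hFsmooth : ContDiff ℝ (⊤ : ℕ∞) (fun x => F (hess n u x)))
    (hharm : ∀ x, lapBel n (fun y => 1 + hess n u y * hess n u y)
      (fun y => F (hess n u y)) x = 0) :
    ∀ x y, F (hess n u x) = F (hess n u y) := by
  obtain ⟨M, hM⟩ := hsemi
  have hm : ∀ x, F (M • (1 : Matrix (Fin n) (Fin n) ℝ)) ≤ F (hess n u x) := fun x =>
    hF _ _ (by simp [Matrix.IsHermitian]) (hess_herm (hM x)) (hM x)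
  rcases hn.eq_or_lt with h1 | h1
  · subst h1
    exact graph_liouville_one hu hFsmooth _ hm hharm
  · exact graph_liouville h1 hu hM hFsmooth _ hm hharm
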